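/- arXiv:2111.02788 — 11 statements merged into one kernel-verified Lean document; each statement's English description precedes it below -/
import Mathlib

section
/- For every odd prime number p, there exist exactly (p+1)/2 ordered quadruples (a,b,c,d) of natural numbers such that p = a·b + c·d and min(a,b) > max(c,d). -/
structure QQ (p a b c d : ℤ) : Prop where
  eq : p = a * b + c * d
  c0 : 0 < c
  d0 : 0 < d
  ca : c < a
  cb : c < b
  da : d < a
  db : d < b

lemma QQ.swap {p a b c d : ℤ} (h : QQ p a b c d) : QQ p b a d c :=
  ⟨by rw [h.eq]; ring, h.d0, h.c0, h.db, h.da, h.cb, h.ca⟩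

lemma QQ.a_lt {p a b c d : ℤ} (h : QQ p a b c d) : a + c < p := by
  obtain ⟨e, c0, d0, ca, cb, da, db⟩ := h
  nlinarith [mul_pos c0 d0]

lemma QQ.cop {p a b c d : ℤ} (hp : Prime p) (h : QQ p a b c d) : IsCoprime a c := by
  have hap := h.a_lt
  obtain ⟨e, c0, d0, ca, cb, da, db⟩ := h
  rw [Int.isCoprime_iff_gcd_eq_one]
  have h1 : ((Int.gcd a c : ℕ) : ℤ) ∣ p := by
    rw [e]
    exact dvd_add (Dvd.dvd.mul_right (Int.gcd_dvd_left ..) _) (Dvd.dvd.mul_right (Int.gcd_dvd_right ..) _)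
  obtain ⟨k, hk⟩ := h1
  rcases hp.irreducible.isUnit_or_isUnit hk with hu | hu
  · simpa using Int.isUnit_iff_natAbs_eq.1 hu
  · exfalso
    have h2 : p ∣ c := by
      rw [hk]
      exact (hu.mul_right_dvd).2 (Int.gcd_dvd_right ..)
    have := Int.le_of_dvd c0 h2
    linarith

lemma dvn {p x y : ℤ} (h : p ∣ x) (e : y = -x) : p ∣ y := by
  rw [e]; exact (Int.dvd_neg).2 h

lemma zero_of {a x : ℤ} (h : a ∣ x) (h1 : x < a) (h2 : -a < x) : x = 0 :=
  Int.eq_zero_of_abs_lt_dvd h (abs_lt.2 ⟨h2, h1⟩)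

lemma bd_eq {p a b c d b' d' : ℤ} (hp : Prime p) (h : QQ p a b c d) (h' : QQ p a b' c d') :
    b = b' ∧ d = d' := by
  have hc := h.cop hp
  obtain ⟨e, c0, d0, ca, cb, da, db⟩ := h
  obtain ⟨e', c0', d0', ca', cb', da', db'⟩ := h'
  have h1 : a ∣ c * (d' - d) := ⟨b - b', by linarith⟩
  have h2 := zero_of (hc.dvd_of_dvd_mul_left h1) (by linarith) (by linarith)
  have h3 : d = d' := by linarith
  subst h3
  refine ⟨?_, rfl⟩
  have : a * b = a * b' := by linarith
  exact mul_left_cancel₀ (by linarith : a ≠ 0) this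

lemma ac_eq {a c a' c' : ℤ} (h : IsCoprime a c) (h' : IsCoprime a' c') (ha : 0 < a) (ha' : 0 < a')
    (e : a * c' = c * a') : a = a' ∧ c = c' := by
  have h1 : a ∣ a' := h.dvd_of_dvd_mul_left ⟨c', e.symm⟩
  have h2 : a' ∣ a := h'.dvd_of_dvd_mul_left ⟨c, by linarith⟩
  have h3 : a = a' := Int.dvd_antisymm ha.le ha'.le h1 h2
  subst h3
  refine ⟨rfl, ?_⟩
  have : a * c' = a * c := by linarith
  exact (mul_left_cancel₀ ha.ne' this).symm

lemma noplus {p a b c d a' b' c' d' : ℤ} (hp : Prime p) (h : QQ p a b c d) (h' : QQ p a' b' c' d')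
    (hab : a ≤ b) (haa : a' ≤ a) (e1 : a * c' + c * a' = p) : False := by
  have hc := h.cop hp
  obtain ⟨e, c0, d0, ca, cb, da, db⟩ := h
  obtain ⟨e', c0', d0', ca', cb', da', db'⟩ := h'
  have h1 : a ∣ c * (a' - d) := ⟨b - c', by linarith⟩
  have h2 := zero_of (hc.dvd_of_dvd_mul_left h1) (by linarith) (by linarith)
  have h3 : a * (b - c') = c * (a' - d) := by linarith
  rw [h2] at h3
  have : 0 < a * (b - c') := mul_pos (by linarith) (by linarith)
  linarith

lemma uniq1 {p a b c d a' b' c' d' : ℤ} (hp : Prime p) (h : QQ p a b c d) (h' : QQ p a' b' c' d')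
    (hab : a ≤ b) (hab' : a' ≤ b') (hd : p ∣ a * c' - c * a' ∨ p ∣ a * c' + c * a') :
    a = a' ∧ b = b' ∧ c = c' ∧ d = d' := by
  have hc := h.cop hp
  have hc' := h'.cop hp
  have hh := h
  have hh' := h'
  obtain ⟨e, c0, d0, ca, cb, da, db⟩ := hh
  obtain ⟨e', c0', d0', ca', cb', da', db'⟩ := hh'
  have k1 : a * a < p := by nlinarith [mul_pos c0 d0]
  have k2 : a' * a' < p := by nlinarith [mul_pos c0' d0']
  have k3 : a * a' < p := by nlinarith [sq_nonneg (a - a')]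
  have k4 : a * c' < p := by nlinarith
  have k5 : c * a' < p := by nlinarith
  have k6 : 0 < a * c' := mul_pos (by linarith) c0'
  have k7 : 0 < c * a' := mul_pos c0 (by linarith)
  rcases hd with hd | hd
  · have := zero_of hd (by linarith) (by linarith)
    obtain ⟨rfl, rfl⟩ := ac_eq hc hc' (by linarith) (by linarith) (by linarith)
    obtain ⟨rfl, rfl⟩ := bd_eq hp h h'
    simp
  · exfalso
    have := zero_of (dvd_sub_self_right.2 hd) (by linarith) (by linarith)
    rcases le_total a' a with hle | hle
    · exact noplus hp h h' hab hle (by linarith)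
    · exact noplus hp h' h hab' hle (by linarith)

lemma uniq2 {p a b c d a' b' c' d' : ℤ} (hp : Prime p) (h : QQ p a b c d) (h' : QQ p a' b' c' d')
    (hab : a ≤ b) (hab' : b' ≤ a') (hd : p ∣ c * d' - a * b' ∨ p ∣ c * d' + a * b') :
    a = a' ∧ b = b' ∧ c = c' ∧ d = d' := by
  have hc := h.cop hp
  have hc' := h'.swap.cop hp
  have hh := h
  have hh' := h'
  obtain ⟨e, c0, d0, ca, cb, da, db⟩ := hh
  obtain ⟨e', c0', d0', ca', cb', da', db'⟩ := hh'
  have k1 : a * a < p := by nlinarith [mul_pos c0 d0]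
  have k2 : b' * b' < p := by nlinarith [mul_pos c0' d0']
  have k3 : a * b' < p := by nlinarith [sq_nonneg (a - b')]
  have k4 : c * d' < a * b' := by nlinarith
  have k6 : 0 < c * d' := mul_pos c0 d0'
  rcases hd with hd | hd
  · have := zero_of hd (by linarith) (by linarith)
    linarith
  · have h0 := zero_of (dvd_sub_self_right.2 hd) (by linarith) (by linarith)
    have h1 : a ∣ (d' - d) := hc.dvd_of_dvd_mul_left (y := c) ⟨b - b', by linarith⟩
    have h2 : b' ∣ (c - c') := hc'.dvd_of_dvd_mul_left (y := d') ⟨a' - a, by linarith⟩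
    rcases lt_or_ge a b' with hl | hl
    · have := zero_of h2 (by linarith) (by linarith)
      have h3 : c = c' := by linarith
      subst h3
      have : b' * a' = b' * a := by linarith
      have := mul_left_cancel₀ (by linarith : b' ≠ 0) this
      linarith
    · have := zero_of h1 (by linarith) (by linarith)
      have h3 : d = d' := by linarith
      subst h3
      have : a * b = a * b' := by linarith
      have := mul_left_cancel₀ (by linarith : a ≠ 0) this
      subst this
      have h4 : a = b := by linarith
      subst h4
      have := zero_of h2 (by linarith) (by linarith)
      have h3 : c = c' := by linarith
      subst h3
      have : a * a' = a * a := by linarith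
      have := mul_left_cancel₀ (by linarith : a ≠ 0) this
      subst this
      simp

lemma ndvd {p c : ℤ} (h0 : 0 < c) (h : c < p) : ¬ p ∣ c := fun hd => by
  have := Int.le_of_dvd h0 hd
  linarith

lemma mixrel {p a b c d a' b' c' d' : ℤ} (hp : Prime p) (h' : QQ p a' b' c' d')
    (hd : p ∣ a * c' - c * a' ∨ p ∣ a * c' + c * a') :
    p ∣ c * d' - a * b' ∨ p ∣ c * d' + a * b' := by
  have := h'.a_lt
  obtain ⟨e', c0', d0', ca', cb', da', db'⟩ := h'
  have hn : ¬ p ∣ c' := ndvd c0' (by linarith)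
  rcases hd with ⟨k, hk⟩ | ⟨k, hk⟩
  · right
    refine (hp.dvd_or_dvd (b := c') ⟨c + b' * k, ?_⟩).resolve_right hn
    linear_combination b' * hk - c * e'
  · left
    refine (hp.dvd_or_dvd (b := c') ⟨c - b' * k, ?_⟩).resolve_right hn
    linear_combination - b' * hk - c * e'

lemma uniq {p a b c d a' b' c' d' : ℤ} (hp : Prime p) (h : QQ p a b c d) (h' : QQ p a' b' c' d')
    (hd : p ∣ a * c' - c * a' ∨ p ∣ a * c' + c * a') :
    a = a' ∧ b = b' ∧ c = c' ∧ d = d' := by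
  have hd2 := mixrel hp (b := b) (d := d) h' hd
  rcases le_total a b with h1 | h1 <;> rcases le_total a' b' with h2 | h2
  · exact uniq1 hp h h' h1 h2 hd
  · exact uniq2 hp h h' h1 h2 hd2
  · have hd3 : p ∣ a' * c - c' * a ∨ p ∣ a' * c + c' * a := by
      rcases hd with hd | hd
      · left
        exact dvn hd (by ring)
      · right
        convert hd using 1; ring
    have := uniq2 hp h' h h2 h1 (mixrel (b := b') (d := d') hp h hd3)
    tauto
  · have hd3 : p ∣ d' * c - b' * a ∨ p ∣ d' * c + b' * a := by
      convert hd2 using 2 <;> ring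
    have hd4 := mixrel (a := d') (b := b) (c := b') (d := d) (a' := a) (b' := b) hp h hd3
    have hd5 : p ∣ b * d' - d * b' ∨ p ∣ b * d' + d * b' := by
      rcases hd4 with hd | hd
      · left
        exact dvn hd (by ring)
      · right
        convert hd using 1; ring
    have := uniq1 hp h.swap h'.swap h1 h2 hd5
    tauto

lemma exA {p m a c : ℤ} (hp : Prime p) (c0 : 0 < c) (ca : c < a) (ap : a < p)
    (hm : p ∣ m * a - c)
    (hmin : ∀ x y : ℤ, p ∣ m * x - y → (x ≠ 0 ∨ y ≠ 0) → a ≤ |x| ∨ a ≤ |y|) :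
    ∃ b d, QQ p a b c d := by
  have ha : ¬ p ∣ a := ndvd (by linarith) ap
  have hcop : IsCoprime a c := by
    rw [Int.isCoprime_iff_gcd_eq_one]
    obtain ⟨x, hx⟩ : ((Int.gcd a c : ℕ) : ℤ) ∣ a := Int.gcd_dvd_left ..
    obtain ⟨y, hy⟩ : ((Int.gcd a c : ℕ) : ℤ) ∣ c := Int.gcd_dvd_right ..
    have g0 : (0:ℤ) < (Int.gcd a c : ℕ) := by
      have : 0 < Int.gcd a c := Int.gcd_pos_of_ne_zero_right _ c0.ne'
      exact_mod_cast this
    generalize hg : Int.gcd a c = g0n at *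
    set g : ℤ := (g0n : ℤ) with hgg
    have x0 : 0 < x := by
      by_contra hh
      nlinarith
    have y0 : 0 < y := by
      by_contra hh
      nlinarith
    have hgp : ¬ p ∣ g := fun h => ha (hx ▸ h.mul_right x)
    have h1 : p ∣ m * x - y := by
      refine (hp.dvd_or_dvd (a := g) ?_).resolve_left hgp
      have e : g * (m * x - y) = m * a - c := by rw [hx, hy]; ring
      rw [e]; exact hm
    have h2 := hmin x y h1 (Or.inl x0.ne')
    rw [abs_of_pos x0, abs_of_pos y0] at h2
    have h3 : a ≤ x := by
      rcases h2 with h2 | h2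
      · exact h2
      · nlinarith
    have h4 : g ≤ 1 := by
      by_contra hh
      nlinarith
    have : g = 1 := by linarith
    rw [hgg] at this
    exact_mod_cast this
  obtain ⟨u, v, huv⟩ := hcop
  set d := (v * p) % a with hd
  have d0 : 0 ≤ d := Int.emod_nonneg _ (by linarith)
  have da : d < a := Int.emod_lt_of_pos _ (by linarith)
  obtain ⟨b, hb⟩ : a ∣ p - c * d := by
    refine ⟨u * p + c * (v * p / a), ?_⟩
    have := Int.emod_add_mul_ediv (v * p) a
    rw [← hd] at this
    linear_combination (-p) * huv - c * this
  have hdn : d ≠ 0 := by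
    intro h0
    rw [h0] at hb
    have hk : p = a * b := by linarith
    rcases hp.irreducible.isUnit_or_isUnit hk with hu | hu
    · rcases Int.isUnit_iff.1 hu with h | h <;> linarith
    · rcases Int.isUnit_iff.1 hu with h | h <;> rw [h] at hk <;> linarith
  have d0' : 0 < d := lt_of_le_of_ne d0 (Ne.symm hdn)
  have hv : p ∣ m * (-d) - b := by
    refine (hp.dvd_or_dvd (a := a) ?_).resolve_left ha
    obtain ⟨k, hk⟩ := hm
    refine ⟨-1 - d * k, ?_⟩
    linear_combination (-d) * hk + hb
  have h5 := hmin (-d) b hv (Or.inl (by simpa using hdn))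
  rw [abs_neg, abs_of_pos d0'] at h5
  have h6 : a ≤ |b| := h5.resolve_left (by linarith)
  have h7 : a ≤ b := by
    rcases le_abs.1 h6 with h | h
    · exact h
    · exfalso
      have : c * d < a * a := by nlinarith
      have : a * b ≤ - (a * a) := by nlinarith
      linarith
  exact ⟨b, d, by linarith, c0, d0', ca, by linarith, da, by linarith⟩

lemma exB {p m a c : ℤ} (hp : Prime p) (c0 : c ≠ 0) (ca : |c| < a) (ap : a < p)
    (hm : p ∣ m * a - c)
    (hmin : ∀ x y : ℤ, p ∣ m * x - y → (x ≠ 0 ∨ y ≠ 0) → a ≤ |x| ∨ a ≤ |y|) :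
    ∃ b d, QQ p a b |c| d := by
  rcases lt_or_gt_of_ne c0 with h | h
  · rw [abs_of_neg h] at *
    refine exA (m := -m) hp (by linarith) ca ap ?_ ?_
    · exact dvn hm (by ring)
    · intro x y hxy h0
      have := hmin x (-y) (by exact dvn hxy (by ring)) (by simpa using h0)
      simpa using this
  · rw [abs_of_pos h] at *
    exact exA hp h ca ap hm hmin

lemma exC {p m : ℤ} (hp : Prime p) (m2 : 2 ≤ m) (mp : m < p - 1) :
    ∃ a b c d, QQ p a b c d ∧ (p ∣ m * a - c ∨ p ∣ m * a + c) := by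
  have hex : ∃ n : ℕ, ∃ x y : ℤ, p ∣ m * x - y ∧ (x ≠ 0 ∨ y ≠ 0) ∧ max |x| |y| = n := by
    refine ⟨m.toNat, 1, m, by simp, by simp, ?_⟩
    rw [abs_of_pos (by linarith : (0:ℤ) < m)]
    simp; omega
  classical
  have hlt : Nat.find hex ≤ m.toNat := by
    apply Nat.find_min'
    refine ⟨1, m, by simp, by simp, ?_⟩
    rw [abs_of_pos (by linarith : (0:ℤ) < m)]
    simp; omega
  have hmin0 : ∀ x y : ℤ, p ∣ m * x - y → (x ≠ 0 ∨ y ≠ 0) → ((Nat.find hex : ℕ) : ℤ) ≤ max |x| |y| := by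
    intro x y h1 h2
    have h3 : 0 ≤ max |x| |y| := le_max_of_le_left (abs_nonneg x)
    have := Nat.find_min' hex (m := (max |x| |y|).toNat) ⟨x, y, h1, h2, by rw [Int.toNat_of_nonneg h3]⟩
    omega
  obtain ⟨x, y, hxy, h0, hN⟩ := Nat.find_spec hex
  generalize Nat.find hex = n at *
  have hap : (n : ℤ) < p := by omega
  generalize (n : ℤ) = N at *
  have hmin : ∀ x y : ℤ, p ∣ m * x - y → (x ≠ 0 ∨ y ≠ 0) → N ≤ |x| ∨ N ≤ |y| := by
    intro x y h1 h2
    exact le_max_iff.1 (hmin0 x y h1 h2)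
  clear hmin0 hlt hex
  have hm : ¬ p ∣ m := ndvd (by linarith) (by linarith)
  have hm1 : ¬ p ∣ m - 1 := ndvd (by linarith) (by linarith)
  have hm2 : ¬ p ∣ m + 1 := ndvd (by linarith) (by linarith)
  have hx' : |x| ≤ N := hN ▸ le_max_left ..
  have hy' : |y| ≤ N := hN ▸ le_max_right ..
  have small : ∀ z : ℤ, |z| ≤ N → p ∣ z → z = 0 := fun z hz hd =>
    Int.eq_zero_of_abs_lt_dvd hd (by linarith)
  have hx0 : x ≠ 0 := by
    rintro rfl
    have := small y hy' (by simpa using hxy)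
    simp_all
  have hy0 : y ≠ 0 := by
    rintro rfl
    have := (hp.dvd_or_dvd (by simpa using hxy)).resolve_left hm
    exact hx0 (small x hx' this)
  have hne : |x| ≠ |y| := by
    intro h
    rcases abs_eq_abs.1 h with h | h
    · subst h
      exact hx0 (small x hx' ((hp.dvd_or_dvd (a := m - 1) (by rw [sub_mul, one_mul]; exact hxy)).resolve_left hm1))
    · subst h
      exact hy0 (small y hy' ((hp.dvd_or_dvd (a := m + 1) (by exact dvn hxy (by ring))).resolve_left hm2))
  rcases lt_or_gt_of_ne hne with h | h
  · rw [max_eq_right h.le] at hN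
    -- inverse of m
    obtain ⟨u, v, huv⟩ : IsCoprime p m := (hp.irreducible.coprime_iff_not_dvd).2 hm
    have inv : ∀ s t : ℤ, p ∣ v * s - t ↔ p ∣ m * t - s := by
      intro s t
      constructor
      · rintro ⟨k, hk⟩
        exact ⟨- m * k - u * s, by linear_combination (-m) * hk + s * huv⟩
      · rintro ⟨k, hk⟩
        exact ⟨- v * k - t*u, by linear_combination (-v) * hk + t * huv⟩
    have hmin' : ∀ x y : ℤ, p ∣ v * x - y → (x ≠ 0 ∨ y ≠ 0) → N ≤ |x| ∨ N ≤ |y| := by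
      intro x y h1 h2
      exact (hmin y x ((inv _ _).1 h1) h2.symm).symm
    have key : ∃ c, c ≠ 0 ∧ |c| < N ∧ p ∣ v * N - c := by
      rcases abs_choice y with hy | hy
      · refine ⟨x, hx0, by linarith, (inv _ _).2 ?_⟩
        rw [← hN, hy]; exact hxy
      · refine ⟨-x, by simpa using hx0, by rw [abs_neg]; linarith, (inv _ _).2 ?_⟩
        rw [← hN, hy]; exact dvn hxy (by ring)
    obtain ⟨c, c0, cN, hc⟩ := key
    obtain ⟨b, d, hq⟩ := exB hp c0 cN hap hc hmin'
    refine ⟨b, N, d, |c|, hq.swap, ?_⟩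
    have hc2 := (inv _ _).1 hc
    have hNp : ¬ p ∣ N := ndvd (by linarith [hq.c0, hq.ca]) hap
    obtain ⟨k, hk⟩ := hc2
    have he := hq.eq
    rcases abs_choice c with hy | hy <;> rw [hy] at he
    · right
      refine (hp.dvd_or_dvd (a := N) ⟨m - d * k, ?_⟩).resolve_left hNp
      linear_combination (-m) * he - d * hk
    · left
      refine (hp.dvd_or_dvd (a := N) ⟨m + d * k, ?_⟩).resolve_left hNp
      linear_combination (-m) * he + d * hk
  · rw [max_eq_left h.le] at hN
    have key : ∃ c, c ≠ 0 ∧ |c| < N ∧ p ∣ m * N - c := by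
      rcases abs_choice x with hy | hy
      · refine ⟨y, hy0, by linarith, ?_⟩
        rw [← hN, hy]; exact hxy
      · refine ⟨-y, by simpa using hy0, by rw [abs_neg]; linarith, ?_⟩
        rw [← hN, hy]; exact dvn hxy (by ring)
    obtain ⟨c, c0, cN, hc⟩ := key
    obtain ⟨b, d, hq⟩ := exB hp c0 cN hap hc hmin
    refine ⟨N, b, |c|, d, hq, ?_⟩
    rcases abs_choice c with hy | hy <;> rw [hy]
    · left; exact hc
    · right; convert hc using 1; ring

/-- the slope of a quadruple -/
lemma slopeQ {p a b c d : ℤ} (hp : Prime p) (hodd : Odd p) (h : QQ p a b c d) :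
    ∃ m, 2 ≤ m ∧ m ≤ (p - 1) / 2 ∧ (p ∣ m * a - c ∨ p ∣ m * a + c) := by
  have hap := h.a_lt
  obtain ⟨e, c0, d0, ca, cb, da, db⟩ := h
  have ha : ¬ p ∣ a := ndvd (by linarith) (by linarith)
  obtain ⟨u, v, huv⟩ : IsCoprime p a := (hp.irreducible.coprime_iff_not_dvd).2 ha
  have p0 : 0 < p := by linarith
  set r := (v * c) % p with hr
  have r0 : 0 ≤ r := Int.emod_nonneg _ (by linarith)
  have rp : r < p := Int.emod_lt_of_pos _ (by linarith)
  have hra : p ∣ r * a - c := by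
    have := Int.emod_add_mul_ediv (v * c) p
    rw [← hr] at this
    exact ⟨-(v * c / p) * a - u * c, by linear_combination a * this + c * huv⟩
  have key : ∀ m, 0 ≤ m → (p ∣ m * a - c ∨ p ∣ m * a + c) → 2 ≤ m := by
    intro m hm hd
    by_contra hh
    have : m = 0 ∨ m = 1 := by omega
    rcases this with rfl | rfl <;> rcases hd with hd | hd
    · exact ndvd (p := p) c0 (by linarith) (by simpa using hd)
    · exact ndvd (p := p) c0 (by linarith) (by simpa using hd)
    · exact ndvd (c := 1 * a - c) (by linarith) (by linarith) hd
    · exact ndvd (c := 1 * a + c) (by linarith) (by linarith) hd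
  obtain ⟨q, hq⟩ := hodd
  by_cases hle : r ≤ (p - 1) / 2
  · exact ⟨r, key r r0 (Or.inl hra), hle, Or.inl hra⟩
  · have : p ∣ (p - r) * a + c := by
      obtain ⟨k, hk⟩ := hra
      exact ⟨a - k, by linear_combination -hk⟩
    exact ⟨p - r, key _ (by linarith) (Or.inr this), by omega, Or.inr this⟩

lemma m_eq {p m m' a c : ℤ} (hp : Prime p) (ha : ¬ p ∣ a) (hm : 2 ≤ m) (hm' : 2 ≤ m')
    (hmp : m ≤ (p - 1) / 2) (hmp' : m' ≤ (p - 1) / 2)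
    (h : p ∣ m * a - c ∨ p ∣ m * a + c) (h' : p ∣ m' * a - c ∨ p ∣ m' * a + c) : m = m' := by
  have h1 : p ∣ m - m' ∨ p ∣ m + m' := by
    rcases h with ⟨k, h⟩ | ⟨k, h⟩ <;> rcases h' with ⟨k', h'⟩ | ⟨k', h'⟩
    · left
      exact (hp.dvd_or_dvd ⟨k - k', by linear_combination h - h'⟩).resolve_right ha
    · right
      exact (hp.dvd_or_dvd ⟨k + k', by linear_combination h + h'⟩).resolve_right ha
    · right
      exact (hp.dvd_or_dvd ⟨k + k', by linear_combination h + h'⟩).resolve_right ha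
    · left
      exact (hp.dvd_or_dvd ⟨k - k', by linear_combination h - h'⟩).resolve_right ha
  rcases h1 with h1 | h1
  · have := zero_of h1 (by omega) (by omega)
    linarith
  · have := Int.le_of_dvd (by linarith) h1
    omega

lemma rel_of {p m a c a' c' : ℤ}
    (h : p ∣ m * a - c ∨ p ∣ m * a + c) (h' : p ∣ m * a' - c' ∨ p ∣ m * a' + c') :
    p ∣ a * c' - c * a' ∨ p ∣ a * c' + c * a' := by
  rcases h with ⟨k, h⟩ | ⟨k, h⟩ <;> rcases h' with ⟨k', h'⟩ | ⟨k', h'⟩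
  · left
    exact ⟨k * a' - k' * a, by linear_combination a' * h - a * h'⟩
  · right
    exact ⟨-k * a' + k' * a, by linear_combination -a' * h + a * h'⟩
  · right
    exact ⟨k * a' - k' * a, by linear_combination a' * h - a * h'⟩
  · left
    exact ⟨-k * a' + k' * a, by linear_combination -a' * h + a * h'⟩

lemma exN {p : ℕ} (hp : p.Prime) (m : ℕ) (m2 : 2 ≤ m) (mp : m ≤ (p - 1) / 2) :
    ∃ q : ℕ × ℕ × ℕ × ℕ, QQ p q.1 q.2.1 q.2.2.1 q.2.2.2 ∧
      ((p : ℤ) ∣ m * q.1 - q.2.2.1 ∨ (p : ℤ) ∣ m * q.1 + q.2.2.1) := by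
  obtain ⟨a, b, c, d, h, h'⟩ := exC (p := p) (m := m) (Nat.prime_iff_prime_int.1 hp) (by omega) (by omega)
  obtain ⟨e, c0, d0, ca, cb, da, db⟩ := id h
  lift a to ℕ using by linarith
  lift b to ℕ using by linarith
  lift c to ℕ using by linarith
  lift d to ℕ using by linarith
  exact ⟨(a, b, c, d), h, h'⟩

lemma cardQ {p : ℕ} (hp : p.Prime) (hodd : Odd p) :
    {q : ℕ × ℕ × ℕ × ℕ | QQ p q.1 q.2.1 q.2.2.1 q.2.2.2}.ncard = (p - 1) / 2 - 1 := by
  have hpz := Nat.prime_iff_prime_int.1 hp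
  have hoz : Odd (p : ℤ) := by exact_mod_cast hodd
  have hex : ∀ m ∈ (Finset.Icc 2 ((p - 1) / 2) : Finset ℕ), ∃ q : ℕ × ℕ × ℕ × ℕ, QQ p q.1 q.2.1 q.2.2.1 q.2.2.2 ∧
      ((p : ℤ) ∣ m * q.1 - q.2.2.1 ∨ (p : ℤ) ∣ m * q.1 + q.2.2.1) := by
    intro m hm
    rw [Finset.mem_Icc] at hm
    exact exN hp m hm.1 hm.2
  choose! f hf using hex
  have : {q : ℕ × ℕ × ℕ × ℕ | QQ p q.1 q.2.1 q.2.2.1 q.2.2.2} =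
      f '' ((Finset.Icc 2 ((p - 1) / 2) : Finset ℕ) : Set ℕ) := by
    ext q
    constructor
    · intro hq
      obtain ⟨m, hm2, hmp, hr⟩ := slopeQ hpz hoz hq
      lift m to ℕ using by linarith
      have hmem : m ∈ (Finset.Icc 2 ((p - 1) / 2) : Finset ℕ) := by
        rw [Finset.mem_Icc]; omega
      refine ⟨m, hmem, ?_⟩
      obtain ⟨h1, h2⟩ := hf m hmem
      obtain ⟨e1, e2, e3, e4⟩ := uniq hpz h1 hq (rel_of h2 hr)
      ext
      · exact_mod_cast e1
      · exact_mod_cast e2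
      · exact_mod_cast e3
      · exact_mod_cast e4
    · rintro ⟨m, hm, rfl⟩
      exact (hf m hm).1
  rw [this, Set.InjOn.ncard_image, Set.ncard_coe_finset, Nat.card_Icc]
  · omega
  · intro m hm m' hm' he
    obtain ⟨h1, h2⟩ := hf m hm
    obtain ⟨h1', h2'⟩ := hf m' hm'
    rw [← he] at h2'
    have := h1.a_lt
    have ha := ndvd (p := p) (c := (f m).1) (by linarith [h1.c0, h1.ca]) (by linarith [h1.c0])
    simp only [Finset.coe_Icc, Set.mem_Icc] at hm hm'
    have := m_eq hpz ha (by omega) (by omega) (by omega) (by omega) h2 h2'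
    exact_mod_cast this

/-- For every odd prime `p` there exist exactly `(p+1)/2` ordered quadruples
`(a,b,c,d)` of natural numbers with `p = a·b + c·d` and `min a b > max c d`. -/
theorem stmt0 (p : ℕ) (hp : p.Prime) (hodd : Odd p) :
    {q : ℕ × ℕ × ℕ × ℕ | p = q.1 * q.2.1 + q.2.2.1 * q.2.2.2 ∧
      max q.2.2.1 q.2.2.2 < min q.1 q.2.1}.ncard = (p + 1) / 2 := by
  have h2 := hp.two_le
  have hset : {q : ℕ × ℕ × ℕ × ℕ | p = q.1 * q.2.1 + q.2.2.1 * q.2.2.2 ∧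
      max q.2.2.1 q.2.2.2 < min q.1 q.2.1} =
      {q : ℕ × ℕ × ℕ × ℕ | QQ p q.1 q.2.1 q.2.2.1 q.2.2.2} ∪ {(1, p, 0, 0), (p, 1, 0, 0)} := by
    ext ⟨a, b, c, d⟩
    simp only [Set.mem_ofPred_eq, Set.mem_union, Set.mem_insert_iff, Set.mem_singleton_iff,
      Prod.mk.injEq, max_lt_iff, lt_min_iff]
    constructor
    · rintro ⟨e, ⟨ca, cb⟩, da, db⟩
      by_cases hz : c * d = 0
      · right
        have e1 : p = a * b := by omega
        have hu := hp
        rw [e1, Nat.prime_mul_iff] at hu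
        rcases hu with ⟨_, rfl⟩ | ⟨_, rfl⟩
        · right; omega
        · left; omega
      · left
        have hc : c ≠ 0 := fun h => hz (by simp [h])
        have hd : d ≠ 0 := fun h => hz (by simp [h])
        exact ⟨by exact_mod_cast e, by omega, by omega, by omega, by omega, by omega, by omega⟩
    · rintro (⟨e, c0, d0, ca, cb, da, db⟩ | ⟨rfl, rfl, rfl, rfl⟩ | ⟨rfl, rfl, rfl, rfl⟩)
      · exact ⟨by exact_mod_cast e, ⟨by omega, by omega⟩, by omega, by omega⟩
      · omega
      · omega
  obtain ⟨k, hk⟩ := hodd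
  have hc := cardQ hp ⟨k, hk⟩
  have hpair : ({(1, p, 0, 0), (p, 1, 0, 0)} : Set (ℕ × ℕ × ℕ × ℕ)).ncard = 2 := by
    apply Set.ncard_pair
    intro h
    simp only [Prod.mk.injEq] at h
    omega
  have hfin : {q : ℕ × ℕ × ℕ × ℕ | QQ p q.1 q.2.1 q.2.2.1 q.2.2.2}.Finite := by
    refine (((Set.finite_Iio p).prod ((Set.finite_Iio p).prod
      ((Set.finite_Iio p).prod (Set.finite_Iio p))))).subset ?_
    rintro ⟨a, b, c, d⟩ h
    have h1 := QQ.a_lt h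
    have h2 := (QQ.swap h).a_lt
    have h3 := h.c0
    have h4 := h.d0
    simp only [Set.mem_prod, Set.mem_Iio] at *
    omega
  rw [hset, Set.ncard_union_eq ?_ hfin (by simp), hc, hpair]
  · omega
  · rw [Set.disjoint_right]
    rintro q (rfl | rfl) h
    · exact absurd h.c0 (by simp)
    · exact absurd h.c0 (by simp)
end

section
/- Two linearly independent elements u, v of a 2-dimensional lattice Λ in ℝ² form a ℤ-basis of Λ if and only if the closed triangle with vertices (0,0), u, v contains no elements of Λ other than its three vertices (0,0), u and v. -/
lemma aux_uniq {u v : ℝ × ℝ} (huv : LinearIndependent ℝ ![u, v]) {a b c d : ℝ}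
    (h : a • u + b • v = c • u + d • v) : a = c ∧ b = d := by
  have := LinearIndependent.pair_iff.1 huv (a - c) (b - d) (by
    rw [sub_smul, sub_smul, sub_add_sub_comm, h, sub_self])
  exact ⟨by linarith [this.1], by linarith [this.2]⟩

lemma aux_hull {u v w : ℝ × ℝ} : w ∈ convexHull ℝ ({0, u, v} : Set (ℝ × ℝ)) ↔
    ∃ a b : ℝ, 0 ≤ a ∧ 0 ≤ b ∧ a + b ≤ 1 ∧ w = a • u + b • v := by
  constructor
  · intro h
    have hsub : convexHull ℝ ({0, u, v} : Set (ℝ × ℝ)) ⊆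
        {w | ∃ a b : ℝ, 0 ≤ a ∧ 0 ≤ b ∧ a + b ≤ 1 ∧ w = a • u + b • v} := by
      apply convexHull_min
      · rintro x (rfl | rfl | rfl)
        · exact ⟨0, 0, by simp⟩
        · exact ⟨1, 0, by simp⟩
        · exact ⟨0, 1, by simp⟩
      · rintro x ⟨a, b, ha, hb, hab, rfl⟩ y ⟨c, d, hc, hd, hcd, rfl⟩ s t hs ht hst
        refine ⟨s * a + t * c, s * b + t * d, by positivity, by positivity, ?_, by module⟩
        nlinarith [mul_le_mul_of_nonneg_left hab hs, mul_le_mul_of_nonneg_left hcd ht]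
    exact hsub h
  · rintro ⟨a, b, ha, hb, hab, rfl⟩
    have hc := convex_convexHull ℝ ({0, u, v} : Set (ℝ × ℝ))
    have h0 : (0 : ℝ × ℝ) ∈ convexHull ℝ ({0, u, v} : Set (ℝ × ℝ)) :=
      subset_convexHull _ _ (by simp)
    have h1 : u ∈ convexHull ℝ ({0, u, v} : Set (ℝ × ℝ)) :=
      subset_convexHull _ _ (by simp)
    have h2 : v ∈ convexHull ℝ ({0, u, v} : Set (ℝ × ℝ)) :=
      subset_convexHull _ _ (by simp)
    have := hc.sum_mem (t := Finset.univ) (w := ![1 - a - b, a, b]) (z := ![0, u, v])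
      (by intro i _; fin_cases i <;> simp <;> linarith)
      (by simp [Fin.sum_univ_three]; ring)
      (by intro i _; fin_cases i <;> simp [h0, h1, h2])
    simpa [Fin.sum_univ_three] using this

lemma aux_span {u v : ℝ × ℝ} (huv : LinearIndependent ℝ ![u, v]) (w : ℝ × ℝ) :
    ∃ a b : ℝ, a • u + b • v = w := by
  have h := huv.span_eq_top_of_card_eq_finrank' (by simp)
  have hw : w ∈ Submodule.span ℝ (Set.range ![u, v]) := by rw [h]; trivial
  have h2 : ∃ a b : ℝ, a • v + b • u = w := by simpa [Submodule.mem_span_pair] using hw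
  obtain ⟨a, b, h⟩ := h2
  exact ⟨b, a, by rw [add_comm, h]⟩

/-- Two linearly independent elements `u, v` of a 2-dimensional lattice `Λ` in `ℝ²`
form a `ℤ`-basis of `Λ` iff the closed triangle with vertices `0, u, v` contains no
elements of `Λ` other than its three vertices. -/
theorem stmt2 (Λ : AddSubgroup (ℝ × ℝ)) (e₁ e₂ : ℝ × ℝ)
    (he : LinearIndependent ℝ ![e₁, e₂])
    (hΛ : Λ = AddSubgroup.closure {e₁, e₂})
    (u v : ℝ × ℝ) (hu : u ∈ Λ) (hv : v ∈ Λ)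
    (huv : LinearIndependent ℝ ![u, v]) :
    AddSubgroup.closure {u, v} = Λ ↔
      ∀ w ∈ Λ, w ∈ convexHull ℝ ({0, u, v} : Set (ℝ × ℝ)) →
        w = 0 ∨ w = u ∨ w = v := by
  constructor
  · rintro rfl w hw hwt
    obtain ⟨m, n, rfl⟩ := AddSubgroup.mem_closure_pair.1 hw
    obtain ⟨a, b, ha, hb, hab, h⟩ := aux_hull.1 hwt
    rw [← Int.cast_smul_eq_zsmul ℝ, ← Int.cast_smul_eq_zsmul ℝ] at h
    obtain ⟨rfl, rfl⟩ := aux_uniq huv h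
    have h1 : 0 ≤ m := by exact_mod_cast ha
    have h2 : 0 ≤ n := by exact_mod_cast hb
    have h3 : m + n ≤ 1 := by exact_mod_cast hab
    have : (m = 0 ∧ n = 0) ∨ (m = 1 ∧ n = 0) ∨ (m = 0 ∧ n = 1) := by omega
    rcases this with ⟨rfl, rfl⟩ | ⟨rfl, rfl⟩ | ⟨rfl, rfl⟩ <;> simp
  · intro H
    have K : ∀ a b : ℝ, 0 ≤ a → 0 ≤ b → a + b ≤ 1 → a • u + b • v ∈ Λ →
        (a = 0 ∧ b = 0) ∨ (a = 1 ∧ b = 0) ∨ (a = 0 ∧ b = 1) := by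
      intro a b ha hb hab hm
      rcases H _ hm (aux_hull.2 ⟨a, b, ha, hb, hab, rfl⟩) with h | h | h
      · exact Or.inl (aux_uniq huv (by rw [h]; simp))
      · exact Or.inr (Or.inl (aux_uniq huv (by rw [h]; simp)))
      · exact Or.inr (Or.inr (aux_uniq huv (by rw [h]; simp)))
    apply le_antisymm
    · rw [AddSubgroup.closure_le]
      rintro x (rfl | rfl) <;> assumption
    · intro w hw
      obtain ⟨a, b, rfl⟩ := aux_span huv w
      have hf : Int.fract a • u + Int.fract b • v ∈ Λ := by
        have := Λ.sub_mem hw (Λ.add_mem (Λ.zsmul_mem hu ⌊a⌋) (Λ.zsmul_mem hv ⌊b⌋))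
        rw [← Int.cast_smul_eq_zsmul ℝ, ← Int.cast_smul_eq_zsmul ℝ] at this
        convert this using 1
        rw [Int.fract, Int.fract]
        module
      have hg : (1 - Int.fract a) • u + (1 - Int.fract b) • v ∈ Λ := by
        have := Λ.sub_mem (Λ.add_mem hu hv) hf
        convert this using 1
        module
      have a0 := Int.fract_nonneg a
      have a1 := Int.fract_lt_one a
      have b0 := Int.fract_nonneg b
      have b1 := Int.fract_lt_one b
      have hz : Int.fract a = 0 ∧ Int.fract b = 0 := by
        rcases le_or_gt (Int.fract a + Int.fract b) 1 with h | h
        · rcases K _ _ a0 b0 h hf with h | h | h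
          · exact h
          · linarith [h.1]
          · linarith [h.2]
        · rcases K _ _ (by linarith) (by linarith) (by linarith) hg with h | h | h <;>
            linarith [h.1, h.2]
      refine AddSubgroup.mem_closure_pair.2 ⟨⌊a⌋, ⌊b⌋, ?_⟩
      rw [← Int.cast_smul_eq_zsmul ℝ, ← Int.cast_smul_eq_zsmul ℝ]
      have ea : (⌊a⌋ : ℝ) = a := by linarith [Int.floor_add_fract a, hz.1]
      have eb : (⌊b⌋ : ℝ) = b := by linarith [Int.floor_add_fract b, hz.2]
      rw [ea, eb]
end

section
/- Let f₁, f₂ be a basis of a 2-dimensional lattice Λ in ℝ², and let g₁ = a·f₁ + b·f₂ and g₂ = c·f₁ + d·f₂ with integers a, b, c, d satisfying |a·d − b·c| = 1 (so that g₁, g₂ is also a basis of Λ). If the sets {f₁, −f₁, f₂, −f₂} and {g₁, −g₁, g₂, −g₂} are disjoint, then a, b, c, d are all nonzero and a·b·c·d > 0; equivalently, {±g₁, ±g₂} is contained in the union of two opposite connected components of ℝ² ∖ (ℝf₁ ∪ ℝf₂). -/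
/-- If `f₁, f₂` is a basis of a 2-dimensional lattice in `ℝ²` and
`g₁ = a•f₁ + b•f₂`, `g₂ = c•f₁ + d•f₂` is another basis (`|ad − bc| = 1`)
such that `{±f₁, ±f₂}` and `{±g₁, ±g₂}` are disjoint, then `a, b, c, d`
are all nonzero and `a·b·c·d > 0` (i.e. `{±g₁, ±g₂}` lies in a pair of
opposite connected components of `ℝ² ∖ (ℝf₁ ∪ ℝf₂)`). -/
theorem stmt3 (f₁ f₂ : ℝ × ℝ) (hf : LinearIndependent ℝ ![f₁, f₂])
    (a b c d : ℤ) (g₁ g₂ : ℝ × ℝ)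
    (hg₁ : g₁ = a • f₁ + b • f₂) (hg₂ : g₂ = c • f₁ + d • f₂)
    (hdet : |a * d - b * c| = 1)
    (hdisj : Disjoint ({f₁, -f₁, f₂, -f₂} : Set (ℝ × ℝ)) ({g₁, -g₁, g₂, -g₂} : Set (ℝ × ℝ))) :
    a ≠ 0 ∧ b ≠ 0 ∧ c ≠ 0 ∧ d ≠ 0 ∧ 0 < a * b * c * d := by
  rw [Set.disjoint_left] at hdisj
  have key : ∀ x y : ℤ, |x * y| = 1 → x = 1 ∨ x = -1 := by
    intro x y h
    have : IsUnit (x * y) := Int.isUnit_iff_abs_eq.mpr h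
    exact Int.isUnit_iff.mp (isUnit_of_mul_isUnit_left this)
  have ha : a ≠ 0 := by
    rintro rfl
    rcases key b c (by simpa using hdet) with rfl | rfl
    · exact hdisj (a := f₂) (by simp) (by simp [hg₁])
    · exact hdisj (a := f₂) (by simp) (by simp [hg₁])
  have hb : b ≠ 0 := by
    rintro rfl
    rcases key a d (by simpa using hdet) with rfl | rfl
    · exact hdisj (a := f₁) (by simp) (by simp [hg₁])
    · exact hdisj (a := f₁) (by simp) (by simp [hg₁])
  have hc : c ≠ 0 := by
    rintro rfl
    rcases key d a (by simpa [mul_comm] using hdet) with rfl | rfl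
    · exact hdisj (a := f₂) (by simp) (by simp [hg₂])
    · exact hdisj (a := f₂) (by simp) (by simp [hg₂])
  have hd : d ≠ 0 := by
    rintro rfl
    rcases key c b (by simpa [mul_comm] using hdet) with rfl | rfl
    · exact hdisj (a := f₁) (by simp) (by simp [hg₂])
    · exact hdisj (a := f₁) (by simp) (by simp [hg₂])
  refine ⟨ha, hb, hc, hd, ?_⟩
  have had : a * d ≠ 0 := mul_ne_zero ha hd
  have hbc : b * c ≠ 0 := mul_ne_zero hb hc
  have e : a * b * c * d = (a * d) * (b * c) := by ring
  rw [e]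
  generalize a * d = p at *
  generalize b * c = q at *
  rcases lt_or_gt_of_ne had with h | h <;> rcases lt_or_gt_of_ne hbc with h' | h'
  · exact mul_pos_of_neg_of_neg h h'
  · rcases (abs_eq (by norm_num)).mp hdet with h1 | h1 <;> omega
  · rcases (abs_eq (by norm_num)).mp hdet with h1 | h1 <;> omega
  · exact mul_pos h h'
end

section
/- A sublattice of finite index in ℤ² cannot have both a black monochromatic basis and a white monochromatic basis; that is, all monochromatic bases of a given lattice have the same colour. -/
/-- The four open black windmill-cones. -/
def Black : Fin 4 → (ℤ × ℤ) → Prop :=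
  ![fun v => 0 < v.2 ∧ v.2 < v.1,
    fun v => 0 < -v.1 ∧ -v.1 < v.2,
    fun v => 0 < -v.2 ∧ -v.2 < -v.1,
    fun v => 0 < v.1 ∧ v.1 < -v.2]

/-- The four open white windmill-cones (images of the black ones under `(x,y) ↦ (y,x)`). -/
def White (i : Fin 4) (v : ℤ × ℤ) : Prop := Black i (v.2, v.1)

/-- `b₁, b₂` is a monochromatic basis of `M` for the cone family `cone`. -/
def IsMonoBasis (cone : Fin 4 → (ℤ × ℤ) → Prop) (M : AddSubgroup (ℤ × ℤ))
    (b₁ b₂ : ℤ × ℤ) : Prop :=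
  AddSubgroup.closure {b₁, b₂} = M ∧
    ∀ i : Fin 4, ∃ v ∈ ({b₁, -b₁, b₂, -b₂} : Set (ℤ × ℤ)), cone i v

def HasBlackBasis (M : AddSubgroup (ℤ × ℤ)) : Prop := ∃ b₁ b₂, IsMonoBasis Black M b₁ b₂

def HasWhiteBasis (M : AddSubgroup (ℤ × ℤ)) : Prop := ∃ b₁ b₂, IsMonoBasis White M b₁ b₂

theorem gen_aux (M : AddSubgroup (ℤ × ℤ)) (b₁ b₂ v w : ℤ × ℤ)
    (hM : AddSubgroup.closure {b₁, b₂} = M)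
    (hv : v ∈ ({b₁, -b₁, b₂, -b₂} : Set (ℤ × ℤ)))
    (hw : w ∈ ({b₁, -b₁, b₂, -b₂} : Set (ℤ × ℤ)))
    (h1 : v ≠ w) (h2 : v ≠ -w) :
    v ∈ M ∧ w ∈ M ∧ ∀ m ∈ M, ∃ x y : ℤ, m.1 = x * v.1 + y * w.1 ∧ m.2 = x * v.2 + y * w.2 := by
  have hb1 : b₁ ∈ M := hM ▸ AddSubgroup.subset_closure (by simp)
  have hb2 : b₂ ∈ M := hM ▸ AddSubgroup.subset_closure (by simp)
  have key : ∀ z ∈ ({b₁, -b₁, b₂, -b₂} : Set (ℤ × ℤ)), z ∈ M := by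
    intro z hz
    simp only [Set.mem_insert_iff, Set.mem_singleton_iff] at hz
    rcases hz with rfl | rfl | rfl | rfl
    · exact hb1
    · exact M.neg_mem hb1
    · exact hb2
    · exact M.neg_mem hb2
  refine ⟨key v hv, key w hw, ?_⟩
  intro m hm
  rw [← hM, AddSubgroup.mem_closure_pair] at hm
  obtain ⟨x, y, rfl⟩ := hm
  simp only [Set.mem_insert_iff, Set.mem_singleton_iff] at hv hw
  rcases hv with rfl | rfl | rfl | rfl <;> rcases hw with rfl | rfl | rfl | rfl <;>
    first
    | exact absurd rfl h1
    | exact absurd rfl h2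
    | exact absurd (neg_neg _).symm h2
    | (refine ⟨x, y, ?_, ?_⟩ <;> simp <;> done)
    | (refine ⟨x, -y, ?_, ?_⟩ <;> simp <;> done)
    | (refine ⟨-x, y, ?_, ?_⟩ <;> simp <;> done)
    | (refine ⟨-x, -y, ?_, ?_⟩ <;> simp <;> done)
    | (refine ⟨y, x, ?_, ?_⟩ <;> simp [add_comm] <;> done)
    | (refine ⟨y, -x, ?_, ?_⟩ <;> simp [add_comm] <;> done)
    | (refine ⟨-y, x, ?_, ?_⟩ <;> simp [add_comm] <;> done)
    | (refine ⟨-y, -x, ?_, ?_⟩ <;> simp [add_comm] <;> done)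

/-- A sublattice of finite index in `ℤ²` cannot have both a black monochromatic basis
and a white monochromatic basis. -/
theorem stmt4 (M : AddSubgroup (ℤ × ℤ)) (hM : M.index ≠ 0) :
    ¬ (HasBlackBasis M ∧ HasWhiteBasis M) := by
  rintro ⟨⟨b₁, b₂, hb, hbc⟩, ⟨c₁, c₂, hc, hcc⟩⟩
  obtain ⟨⟨a, b⟩, hu, hu'⟩ := hbc 0
  obtain ⟨⟨c, d⟩, hw, hw'⟩ := hbc 1
  obtain ⟨⟨p, q⟩, hs, hs'⟩ := hcc 0
  obtain ⟨⟨r, s⟩, ht, ht'⟩ := hcc 1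
  simp only [White, Black, Matrix.cons_val_zero, Matrix.cons_val_one] at hu' hw' hs' ht'
  obtain ⟨m1, m2, m3⟩ := gen_aux M _ _ _ _ hb hu hw
    (by simp only [ne_eq, Prod.mk.injEq]; omega)
    (by simp only [ne_eq, Prod.neg_mk, Prod.mk.injEq]; omega)
  obtain ⟨n1, n2, n3⟩ := gen_aux M _ _ _ _ hc hs ht
    (by simp only [ne_eq, Prod.mk.injEq]; omega)
    (by simp only [ne_eq, Prod.neg_mk, Prod.mk.injEq]; omega)
  obtain ⟨x, y, e1, e2⟩ := m3 _ n1
  obtain ⟨z, t, e3, e4⟩ := m3 _ n2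
  obtain ⟨x', y', e5, e6⟩ := n3 _ m1
  obtain ⟨z', t', e7, e8⟩ := n3 _ m2
  simp only at e1 e2 e3 e4 e5 e6 e7 e8
  obtain ⟨ha, hab⟩ := hu'
  obtain ⟨hc0, hcd⟩ := hw'
  obtain ⟨hp, hpq⟩ := hs'
  obtain ⟨hs0, hsr⟩ := ht'
  have hD : 0 < a * d - b * c := by nlinarith
  have hx : 0 < x := by
    have : 0 < x * (a * d - b * c) := by
      have : x * (a * d - b * c) = p * d - q * c := by rw [e1, e2]; ring
      rw [this]; nlinarith
    exact pos_of_mul_pos_left this hD.le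
  have hy : 0 < y := by
    have : 0 < y * (a * d - b * c) := by
      have : y * (a * d - b * c) = a * q - b * p := by rw [e1, e2]; ring
      rw [this]; nlinarith
    exact pos_of_mul_pos_left this hD.le
  have hz : 0 < z := by
    have : 0 < z * (a * d - b * c) := by
      have : z * (a * d - b * c) = r * d - s * c := by rw [e3, e4]; ring
      rw [this]; nlinarith
    exact pos_of_mul_pos_left this hD.le
  have ht : 0 < -t := by
    have : 0 < (-t) * (a * d - b * c) := by
      have : (-t) * (a * d - b * c) = b * r - a * s := by rw [e3, e4]; ring
      rw [this]; nlinarith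
    exact pos_of_mul_pos_left this hD.le
  have hdet : p * s - q * r = (x * t - y * z) * (a * d - b * c) := by
    rw [e1, e2, e3, e4]; ring
  have hdet' : a * d - b * c = (x' * t' - y' * z') * (p * s - q * r) := by
    rw [e5, e6, e7, e8]; ring
  have h1 : (x' * t' - y' * z') * (x * t - y * z) = 1 := by
    apply mul_right_cancel₀ hD.ne'
    rw [mul_assoc, ← hdet, ← hdet', one_mul]
  have h2 := Int.isUnit_iff.mp (IsUnit.of_mul_eq_one_right _ h1)
  have h3 : x * t - y * z ≤ -2 := by nlinarith
  omega
end

section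
/- Let p be an odd prime and let μ be an integer with 2 ≤ μ ≤ p−2. Then every one of the eight open windmill-cones contains a nonzero element (x,y) of Λ_μ(p) with |x| ≤ p−1 and |y| ≤ p−1. -/
/-- The sublattice `Λ_μ(p) = {(x,y) ∈ ℤ² : x + μ·y ≡ 0 (mod p)}` of `ℤ²`. -/
def Lam (p : ℕ) (μ : ℤ) : AddSubgroup (ℤ × ℤ) where
  carrier := {v : ℤ × ℤ | (p : ℤ) ∣ v.1 + μ * v.2}
  zero_mem' := by simp
  add_mem' := by
    intro a b ha hb
    have h : (a + b).1 + μ * (a + b).2 = (a.1 + μ * a.2) + (b.1 + μ * b.2) := by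
      simp only [Prod.fst_add, Prod.snd_add]; ring
    simpa only [Set.mem_setOf_eq, h] using dvd_add ha hb
  neg_mem' := by
    intro a ha
    have h : (-a).1 + μ * (-a).2 = -(a.1 + μ * a.2) := by
      simp only [Prod.fst_neg, Prod.snd_neg]; ring
    simpa only [Set.mem_setOf_eq, h] using dvd_neg.mpr ha

/-- Membership criterion packaged with the size bounds. -/
theorem aux_mem (p : ℕ) (μ x y k : ℤ) (C : ℤ × ℤ → Prop) (hk : x + μ * y = p * k)
    (hx : |x| ≤ (p : ℤ) - 1) (hy : |y| ≤ (p : ℤ) - 1) (h0 : y ≠ 0) (hC : C (x, y)) :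
    ∃ v ∈ Lam p μ, v ≠ 0 ∧ |v.1| ≤ (p : ℤ) - 1 ∧ |v.2| ≤ (p : ℤ) - 1 ∧ C v := by
  refine ⟨(x, y), ⟨k, hk⟩, ?_, hx, hy, hC⟩
  intro h
  exact h0 (congrArg Prod.snd h)


/-- For an odd prime `p` and `2 ≤ μ ≤ p−2`, every one of the eight open
windmill-cones contains a nonzero element `(x,y)` of `Λ_μ(p)` with
`|x| ≤ p−1` and `|y| ≤ p−1`. -/
theorem stmt7 (p : ℕ) (hp : p.Prime) (hodd : Odd p)
    (μ : ℤ) (hμ₁ : 2 ≤ μ) (hμ₂ : μ ≤ (p : ℤ) - 2) :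
    ∀ i : Fin 4,
      (∃ v ∈ Lam p μ, v ≠ 0 ∧ |v.1| ≤ (p : ℤ) - 1 ∧ |v.2| ≤ (p : ℤ) - 1 ∧ Black i v) ∧
      (∃ v ∈ Lam p μ, v ≠ 0 ∧ |v.1| ≤ (p : ℤ) - 1 ∧ |v.2| ≤ (p : ℤ) - 1 ∧ White i v) := by
  intro i
  fin_cases i
  · refine ⟨aux_mem p μ ((p - μ)) ((1)) ((1)) _ (by ring)
      (abs_le.mpr ⟨by omega, by omega⟩) (abs_le.mpr ⟨by omega, by omega⟩) (by omega) ?_, aux_mem p μ ((μ)) ((p - 1)) ((μ)) _ (by ring)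
      (abs_le.mpr ⟨by omega, by omega⟩) (abs_le.mpr ⟨by omega, by omega⟩) (by omega) ?_⟩
    · simp [Black]; omega
    · simp [White, Black]; omega
  · refine ⟨aux_mem p μ ((μ - p)) ((p - 1)) ((μ - 1)) _ (by ring)
      (abs_le.mpr ⟨by omega, by omega⟩) (abs_le.mpr ⟨by omega, by omega⟩) (by omega) ?_, aux_mem p μ (-(-μ)) (-(1)) (-(0)) _ (by ring)
      (abs_le.mpr ⟨by omega, by omega⟩) (abs_le.mpr ⟨by omega, by omega⟩) (by omega) ?_⟩
    · simp [Black]; omega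
    · simp [White, Black]; omega
  · refine ⟨aux_mem p μ (-(p - μ)) (-(1)) (-(1)) _ (by ring)
      (abs_le.mpr ⟨by omega, by omega⟩) (abs_le.mpr ⟨by omega, by omega⟩) (by omega) ?_, aux_mem p μ (-(μ)) (-(p - 1)) (-(μ)) _ (by ring)
      (abs_le.mpr ⟨by omega, by omega⟩) (abs_le.mpr ⟨by omega, by omega⟩) (by omega) ?_⟩
    · simp [Black]; omega
    · simp [White, Black]; omega
  · refine ⟨aux_mem p μ (-(μ - p)) (-(p - 1)) (-(μ - 1)) _ (by ring)
      (abs_le.mpr ⟨by omega, by omega⟩) (abs_le.mpr ⟨by omega, by omega⟩) (by omega) ?_, aux_mem p μ ((-μ)) ((1)) ((0)) _ (by ring)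
      (abs_le.mpr ⟨by omega, by omega⟩) (abs_le.mpr ⟨by omega, by omega⟩) (by omega) ?_⟩
    · simp [Black]; omega
    · simp [White, Black]; omega
end

section
/- Every lattice Λ_μ(p), where p is an odd prime and μ is an integer with 2 ≤ μ ≤ p−2, has a monochromatic basis: it has either a black monochromatic basis or a white monochromatic basis. -/
theorem closure_eq_Lam (p : ℕ) (hp : 0 < p) (μ a b c d : ℤ)
    (h1 : (p : ℤ) ∣ a + μ * b) (h2 : (p : ℤ) ∣ -c + μ * d) (hd : a * d + b * c = p) :
    AddSubgroup.closure {((a, b) : ℤ × ℤ), (-c, d)} = Lam p μ := by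
  have hp0 : (p : ℤ) ≠ 0 := by exact_mod_cast hp.ne'
  apply le_antisymm
  · rw [AddSubgroup.closure_le]
    rintro v (rfl | rfl)
    · exact h1
    · exact h2
  · rintro ⟨x, y⟩ hv
    have hv' : (p : ℤ) ∣ x + μ * y := hv
    obtain ⟨k, hk⟩ := hv'
    obtain ⟨k1, hk1⟩ := h1
    obtain ⟨k2, hk2⟩ := h2
    rw [AddSubgroup.mem_closure_pair]
    have hs : (p : ℤ) * (k * d - k2 * y) = x * d + c * y := by
      linear_combination (-d) * hk + y * hk2
    have ht : (p : ℤ) * (k1 * y - b * k) = a * y - b * x := by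
      linear_combination b * hk - y * hk1
    refine ⟨k * d - k2 * y, k1 * y - b * k, ?_⟩
    ext
    · simp only [Prod.fst_add, Prod.smul_fst, smul_eq_mul]
      apply mul_left_cancel₀ hp0
      linear_combination a * hs - c * ht + x * hd
    · simp only [Prod.snd_add, Prod.smul_snd, smul_eq_mul]
      apply mul_left_cancel₀ hp0
      linear_combination b * hs + d * ht + y * hd

theorem black_of (p : ℕ) (hp : 0 < p) (μ a b c d : ℤ)
    (h1 : (p : ℤ) ∣ a + μ * b) (h2 : (p : ℤ) ∣ -c + μ * d) (hd : a * d + b * c = p)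
    (hb : 0 < b) (hab : b < a) (hc : 0 < c) (hcd : c < d) : HasBlackBasis (Lam p μ) := by
  refine ⟨(a, b), (-c, d), closure_eq_Lam p hp μ a b c d h1 h2 hd, ?_⟩
  intro i
  fin_cases i
  · exact ⟨(a, b), by simp, by simp [Black]; omega⟩
  · exact ⟨(-c, d), by simp, by simp [Black]; omega⟩
  · exact ⟨-(a, b), by simp, by simp [Black]; omega⟩
  · exact ⟨-(-c, d), by simp, by simp [Black]; omega⟩

theorem white_of (p : ℕ) (hp : 0 < p) (μ a b c d : ℤ)
    (h1 : (p : ℤ) ∣ a + μ * b) (h2 : (p : ℤ) ∣ -c + μ * d) (hd : a * d + b * c = p)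
    (ha : 0 < a) (hab : a < b) (hdd : 0 < d) (hcd : d < c) : HasWhiteBasis (Lam p μ) := by
  refine ⟨(a, b), (-c, d), closure_eq_Lam p hp μ a b c d h1 h2 hd, ?_⟩
  intro i
  fin_cases i
  · exact ⟨(a, b), by simp, by simp [White, Black]; omega⟩
  · exact ⟨-(-c, d), by simp, by simp [White, Black]; omega⟩
  · exact ⟨-(a, b), by simp, by simp [White, Black]; omega⟩
  · exact ⟨(-c, d), by simp, by simp [White, Black]; omega⟩

theorem descend (p : ℕ) (hp : p.Prime) (μ : ℤ) (hμ₁ : 2 ≤ μ) (hμ₂ : μ ≤ (p : ℤ) - 2) (n : ℕ) :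
    ∀ a b c d : ℤ, a + c ≤ n → (p : ℤ) ∣ a + μ * b → (p : ℤ) ∣ -c + μ * d →
      a * d + b * c = p → 0 < b → b < a → 0 < d → d < c →
      HasBlackBasis (Lam p μ) ∨ HasWhiteBasis (Lam p μ) := by
  have hpZ : Prime (p : ℤ) := Nat.prime_iff_prime_int.mp hp
  induction n with
  | zero => intro a b c d hn; intros; push_cast at hn; omega
  | succ n ih =>
    intro a b c d hn h1 h2 hd hb hab hdd hdc
    push_cast at hn
    have hpa : a < p := by nlinarith
    have hpc : c < p := by nlinarith
    have h3 : (p : ℤ) ∣ (a - c) + μ * (b + d) := by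
      have := dvd_add h1 h2
      ring_nf at this ⊢
      exact this
    rcases lt_trichotomy a c with hac | hac | hac
    · have h4 : (p : ℤ) ∣ -(c - a) + μ * (b + d) := by
        rwa [neg_sub]
      rcases lt_trichotomy (c - a) (b + d) with h | h | h
      · left
        exact black_of p hp.pos μ a b (c - a) (b + d) h1 h4 (by linarith) hb hab (by omega) h
      · exfalso
        rw [← h] at h4
        have h5 : (p : ℤ) ∣ (μ - 1) * (c - a) := by
          ring_nf at h4 ⊢
          exact h4
        rcases hpZ.dvd_or_dvd h5 with h6 | h6
        · have := Int.le_of_dvd (by omega) h6; omega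
        · have := Int.le_of_dvd (by omega) h6; omega
      · exact ih a b (c - a) (b + d) (by omega) h1 h4 (by linarith) hb hab (by omega) h
    · exfalso
      subst hac
      have h5 : (p : ℤ) ∣ a * (b + d) := ⟨1, by linarith⟩
      rcases hpZ.dvd_or_dvd h5 with h6 | h6
      · have := Int.le_of_dvd (by omega) h6; omega
      · have := Int.le_of_dvd (by omega) h6; nlinarith
    · rcases lt_trichotomy (a - c) (b + d) with h | h | h
      · right
        exact white_of p hp.pos μ (a - c) (b + d) c d h3 h2 (by linarith) (by omega) h hdd hdc
      · exfalso
        rw [← h] at h3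
        have h5 : (p : ℤ) ∣ (μ + 1) * (a - c) := by
          ring_nf at h3 ⊢
          exact h3
        rcases hpZ.dvd_or_dvd h5 with h6 | h6
        · have := Int.le_of_dvd (by omega) h6; omega
        · have := Int.le_of_dvd (by omega) h6; omega
      · exact ih (a - c) (b + d) c d (by omega) h3 h2 (by linarith) (by omega) h hdd hdc

/-- Every lattice `Λ_μ(p)` with `p` an odd prime and `2 ≤ μ ≤ p−2` has a
monochromatic basis, black or white. -/
theorem stmt8 (p : ℕ) (hp : p.Prime) (hodd : Odd p)
    (μ : ℤ) (hμ₁ : 2 ≤ μ) (hμ₂ : μ ≤ (p : ℤ) - 2) :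
    HasBlackBasis (Lam p μ) ∨ HasWhiteBasis (Lam p μ) := by
  exact descend p hp μ hμ₁ hμ₂ p (p - μ) 1 μ 1 (by omega) (by simp) (by simp) (by ring)
    (by omega) (by omega) (by omega) (by omega)
end

section
/- A reduced black monochromatic basis of a lattice Λ_μ(p) is uniquely determined by either one of its two elements: if u=(a,c), v=(−d,b) and u'=(a',c'), v'=(−d',b') are two reduced black monochromatic bases of the same lattice Λ_μ(p), and either u = u' or v = v', then u = u' and v = v'. -/
/-- `u, v` is a *reduced* black monochromatic basis of `M`:
a black monochromatic basis of the form `u = (a,c)`, `v = (-d,b)` with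
natural numbers `a,b,c,d` satisfying `min a b > max c d`. -/
def IsRedBlackBasis (M : AddSubgroup (ℤ × ℤ)) (u v : ℤ × ℤ) : Prop :=
  IsMonoBasis Black M u v ∧
    ∃ a b c d : ℕ, u = ((a : ℤ), (c : ℤ)) ∧ v = (-(d : ℤ), (b : ℤ)) ∧ max c d < min a b

lemma aux_one {D D' n k : ℤ} (hD : 0 < D) (hD' : 0 < D') (h1 : D' = n * D) (h2 : D = k * D') :
    n = 1 := by
  have h3 : D = D' := Int.dvd_antisymm hD.le hD'.le ⟨n, by rw [h1]; ring⟩ ⟨k, by rw [h2]; ring⟩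
  subst h3
  have : (n - 1) * D = 0 := by linarith
  rcases mul_eq_zero.mp this with h | h <;> linarith

lemma aux_zero {m a x y : ℤ} (hx : 0 ≤ x) (hxa : x < a) (hy : 0 ≤ y) (hya : y < a)
    (h : x = y + m * a) : m = 0 := by
  have h1 : m < 1 := by
    by_contra hc
    nlinarith
  have h2 : -1 < m := by
    by_contra hc
    nlinarith
  omega

/-- A reduced black monochromatic basis of `Λ_μ(p)` is uniquely determined by
either one of its two elements. -/
theorem stmt9 (p : ℕ) (hp : p.Prime) (hodd : Odd p)
    (μ : ℤ) (hμ₁ : 2 ≤ μ) (hμ₂ : μ ≤ (p : ℤ) - 2)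
    (u v u' v' : ℤ × ℤ)
    (h : IsRedBlackBasis (Lam p μ) u v) (h' : IsRedBlackBasis (Lam p μ) u' v')
    (heq : u = u' ∨ v = v') :
    u = u' ∧ v = v' := by
  obtain ⟨⟨hc, -⟩, a, b, c, d, rfl, rfl, hlt⟩ := h
  obtain ⟨⟨hc', -⟩, a', b', c', d', rfl, rfl, hlt'⟩ := h'
  rw [max_lt_iff, lt_min_iff, lt_min_iff] at hlt hlt'
  obtain ⟨⟨l1, l2⟩, l3, l4⟩ := hlt
  obtain ⟨⟨l1', l2'⟩, l3', l4'⟩ := hlt'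
  have hcc := hc.trans hc'.symm
  zify at l1 l2 l3 l4 l1' l2' l3' l4'
  have pa := Int.natCast_nonneg a
  have pb := Int.natCast_nonneg b
  have pc := Int.natCast_nonneg c
  have pd := Int.natCast_nonneg d
  have pa' := Int.natCast_nonneg a'
  have pb' := Int.natCast_nonneg b'
  have pc' := Int.natCast_nonneg c'
  have pd' := Int.natCast_nonneg d'
  have hD : 0 < (a * b + c * d : ℤ) := by
    have : 0 < (a * b : ℤ) := mul_pos (by linarith) (by linarith)
    positivity
  have hD' : 0 < (a' * b' + c' * d' : ℤ) := by
    have : 0 < (a' * b' : ℤ) := mul_pos (by linarith) (by linarith)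
    positivity
  rcases heq with heq | heq
  · have e1 := congrArg Prod.fst heq
    have e2 := congrArg Prod.snd heq
    simp only at e1 e2
    have m1 : ((-(d' : ℤ), (b' : ℤ)) : ℤ × ℤ) ∈ AddSubgroup.closure
        {((a : ℤ), (c : ℤ)), (-(d : ℤ), (b : ℤ))} := by
      rw [hcc]; exact AddSubgroup.subset_closure (by simp)
    have m2 : ((-(d : ℤ), (b : ℤ)) : ℤ × ℤ) ∈ AddSubgroup.closure
        {((a' : ℤ), (c' : ℤ)), (-(d' : ℤ), (b' : ℤ))} := by
      rw [← hcc]; exact AddSubgroup.subset_closure (by simp)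
    rw [AddSubgroup.mem_closure_pair] at m1 m2
    obtain ⟨m, n, h1⟩ := m1
    obtain ⟨k, l, h2⟩ := m2
    simp only [Prod.smul_mk, Prod.mk_add_mk, Prod.mk.injEq, smul_eq_mul] at h1 h2
    obtain ⟨h1, h3⟩ := h1
    obtain ⟨h2, h4⟩ := h2
    obtain rfl := Int.natCast_inj.mp e1
    obtain rfl := Int.natCast_inj.mp e2
    have hn : n = 1 := aux_one (k := l) hD hD'
      (by linear_combination (c : ℤ) * h1 - (a : ℤ) * h3)
      (by linear_combination (c : ℤ) * h2 - (a : ℤ) * h4)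
    subst hn
    have hm : m = 0 := aux_zero (a := a) pd (by assumption) pd' (by assumption) (by linarith)
    subst hm
    refine ⟨rfl, Prod.ext ?_ ?_⟩ <;> simp only <;> linarith
  · have e1 := congrArg Prod.fst heq
    have e2 := congrArg Prod.snd heq
    simp only [neg_inj] at e1 e2
    have m1 : (((a' : ℤ), (c' : ℤ)) : ℤ × ℤ) ∈ AddSubgroup.closure
        {((a : ℤ), (c : ℤ)), (-(d : ℤ), (b : ℤ))} := by
      rw [hcc]; exact AddSubgroup.subset_closure (by simp)
    have m2 : (((a : ℤ), (c : ℤ)) : ℤ × ℤ) ∈ AddSubgroup.closure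
        {((a' : ℤ), (c' : ℤ)), (-(d' : ℤ), (b' : ℤ))} := by
      rw [← hcc]; exact AddSubgroup.subset_closure (by simp)
    rw [AddSubgroup.mem_closure_pair] at m1 m2
    obtain ⟨m, n, h1⟩ := m1
    obtain ⟨k, l, h2⟩ := m2
    simp only [Prod.smul_mk, Prod.mk_add_mk, Prod.mk.injEq, smul_eq_mul] at h1 h2
    obtain ⟨h1, h3⟩ := h1
    obtain ⟨h2, h4⟩ := h2
    obtain rfl := Int.natCast_inj.mp e1
    obtain rfl := Int.natCast_inj.mp e2
    have hn : m = 1 := aux_one (k := k) hD hD'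
      (by linear_combination -(b : ℤ) * h1 - (d : ℤ) * h3)
      (by linear_combination -(b : ℤ) * h2 - (d : ℤ) * h4)
    subst hn
    have hm : n = 0 := aux_zero (a := b) pc' (by assumption) pc (by assumption) (by linarith)
    subst hm
    refine ⟨Prod.ext ?_ ?_, rfl⟩ <;> simp only <;> linarith
end

section
/- Let p be an odd prime and let μ be an integer with 2 ≤ μ ≤ p−2. Then either every monochromatic basis of Λ_μ(p) is white, or Λ_μ(p) has a unique reduced black monochromatic basis: there is exactly one quadruple (a,b,c,d) of natural numbers with min(a,b) > max(c,d) such that (a,c) and (−d,b) generate Λ_μ(p). -/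
theorem lam_mem (p : ℕ) (μ x y : ℤ) : (x, y) ∈ Lam p μ ↔ (p : ℤ) ∣ x + μ * y := Iff.rfl

theorem lam_det (p : ℕ) (μ x y z w : ℤ) (h1 : (x, y) ∈ Lam p μ) (h2 : (z, w) ∈ Lam p μ) :
    (p : ℤ) ∣ x * w - y * z := by
  rw [lam_mem] at h1 h2
  have : x * w - y * z = (x + μ * y) * w - (z + μ * w) * y := by ring
  rw [this]
  exact dvd_sub (h1.mul_right _) (h2.mul_right _)

theorem lam_basis_mp (p : ℕ) (μ x y z w : ℤ)
    (h : AddSubgroup.closure ({(x, y), (z, w)} : Set (ℤ × ℤ)) = Lam p μ) :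
    (x, y) ∈ Lam p μ ∧ (z, w) ∈ Lam p μ ∧ (x * w - y * z = p ∨ x * w - y * z = -p) := by
  have h1 : (x, y) ∈ Lam p μ := by
    rw [← h]; exact AddSubgroup.subset_closure (by simp)
  have h2 : (z, w) ∈ Lam p μ := by
    rw [← h]; exact AddSubgroup.subset_closure (by simp)
  refine ⟨h1, h2, ?_⟩
  have h3 : ((p : ℤ), (0 : ℤ)) ∈ Lam p μ := by rw [lam_mem]; simp
  have h4 : (-μ, (1 : ℤ)) ∈ Lam p μ := by rw [lam_mem]; simp
  rw [← h, AddSubgroup.mem_closure_pair] at h3 h4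
  obtain ⟨m, n, h3⟩ := h3
  obtain ⟨k, l, h4⟩ := h4
  simp only [Prod.smul_mk, Prod.mk_add_mk, Prod.mk.injEq, smul_eq_mul] at h3 h4
  have hd : x * w - y * z ∣ (p : ℤ) := by
    refine ⟨m * l - n * k, ?_⟩
    have : (p : ℤ) = (m * x + n * z) * (k * y + l * w) - (m * y + n * w) * (k * x + l * z) := by
      rw [h3.1, h3.2, h4.1, h4.2]; ring
    rw [this]; ring
  have := Int.natAbs_eq_of_dvd_dvd hd (lam_det p μ x y z w h1 h2)
  omega

theorem lam_basis_mpr (p : ℕ) (hp : p ≠ 0) (μ x y z w : ℤ)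
    (h1 : (x, y) ∈ Lam p μ) (h2 : (z, w) ∈ Lam p μ) (hd : x * w - y * z = p) :
    AddSubgroup.closure ({(x, y), (z, w)} : Set (ℤ × ℤ)) = Lam p μ := by
  have hp' : (p : ℤ) ≠ 0 := by exact_mod_cast hp
  apply le_antisymm
  · rw [AddSubgroup.closure_le]
    rintro v (rfl | rfl)
    · exact h1
    · exact h2
  · rintro ⟨s, t⟩ h
    rw [AddSubgroup.mem_closure_pair]
    obtain ⟨m, hm⟩ := lam_det p μ s t z w h h2
    obtain ⟨n, hn⟩ := lam_det p μ x y s t h1 h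
    refine ⟨m, n, ?_⟩
    simp only [Prod.smul_mk, Prod.mk_add_mk, Prod.mk.injEq, smul_eq_mul]
    constructor
    · apply mul_left_cancel₀ hp'
      linear_combination (-x) * hm - z * hn + s * hd
    · apply mul_left_cancel₀ hp'
      linear_combination (-y) * hm - w * hn + t * hd

theorem core_descent (p : ℕ) (hp : p.Prime) (μ : ℤ) (hμ₁ : 2 ≤ μ) (hμ₂ : μ ≤ (p : ℤ) - 2) (N : ℕ) :
    ∀ a b c d : ℤ, 0 < c → c < a → 0 < d → d < b → c + d ≤ N → a * b + c * d = p →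
      (a, c) ∈ Lam p μ → (-d, b) ∈ Lam p μ →
      ∃ a b c d : ℤ, 0 < c ∧ 0 < d ∧ c < a ∧ d < a ∧ c < b ∧ d < b ∧ a * b + c * d = p ∧
      (a, c) ∈ Lam p μ ∧ (-d, b) ∈ Lam p μ := by
  induction N with
  | zero => intro a b c d; intros; omega
  | succ N ih =>
    intro a b c d hc hca hd hdb hN hD hu hv
    by_cases h1 : a ≤ d
    · have hm : (-(d - a), b + c) ∈ Lam p μ := by
        have := add_mem hu hv
        rw [Prod.mk_add_mk] at this
        convert this using 2 <;> ring
      have hne : d - a ≠ 0 := by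
        intro h0
        rw [lam_mem, h0, neg_zero, zero_add] at hm
        rcases (Nat.prime_iff_prime_int.mp hp).dvd_or_dvd hm with h | h
        · have := Int.le_of_dvd (by omega) h; omega
        · have := Int.le_of_dvd (by omega) h; nlinarith
      refine ih a (b + c) c (d - a) hc hca (by omega) (by omega) (by push_cast at hN; omega) ?_ hu hm
      linear_combination hD
    by_cases h2 : b ≤ c
    · have hm : (a + d, c - b) ∈ Lam p μ := by
        have := sub_mem hu hv
        rw [Prod.mk_sub_mk] at this
        convert this using 2; ring
      have hne : c - b ≠ 0 := by
        intro h0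
        rw [lam_mem, h0, mul_zero, add_zero] at hm
        have := Int.le_of_dvd (by omega) hm; nlinarith
      refine ih (a + d) b (c - b) d (by omega) (by omega) hd hdb (by push_cast at hN; omega) ?_ hm hv
      linear_combination hD
    exact ⟨a, b, c, d, hc, hd, hca, by omega, by omega, hdb, hD, hu, hv⟩

theorem core_uniq (a b c d a' b' c' d' m n k l : ℤ)
    (hc : 0 < c) (hd : 0 < d) (h1 : c < a) (h2 : d < a) (h3 : c < b) (h4 : d < b)
    (hc' : 0 < c') (hd' : 0 < d') (h1' : c' < a') (h2' : d' < a') (h3' : c' < b') (h4' : d' < b')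
    (e1 : a' = m * a - n * d) (e2 : c' = m * c + n * b)
    (e3 : -d' = k * a - l * d) (e4 : b' = k * c + l * b) (hdet : m * l - n * k = 1)
    (hn : 1 ≤ n) (hm : 1 ≤ m) (hl : 1 ≤ l) : False := by
  have f4 : d = k * a' + m * d' := by
    linear_combination (-k) * e1 + m * e3 - d * hdet
  have hk : 0 ≤ k := by
    by_contra h
    have : 1 ≤ -k := by omega
    nlinarith [mul_pos (show 0 < m by omega) (show 0 < l by omega), mul_pos (show 0 < n by omega) (show 0 < -k by omega)]
  have hmc : 0 < m * c := by positivity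
  have hnb : b ≤ n * b := by nlinarith
  rcases hk.eq_or_lt with rfl | hk
  · have : m = 1 ∧ l = 1 := by
      constructor <;> nlinarith
    obtain ⟨rfl, rfl⟩ := this
    nlinarith
  · have : a' ≤ k * a' := by nlinarith
    have : 0 < m * d' := by positivity
    omega

theorem red_pos (p : ℕ) (hp : p.Prime) (μ : ℤ) (hμ₁ : 2 ≤ μ) (hμ₂ : μ ≤ (p : ℤ) - 2) (a b c d : ℕ)
    (h : max c d < min a b)
    (hcl : AddSubgroup.closure ({((a : ℤ), (c : ℤ)), (-(d : ℤ), (b : ℤ))} : Set (ℤ × ℤ)) = Lam p μ) :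
    0 < (c : ℤ) ∧ 0 < (d : ℤ) ∧ (a * b + c * d : ℤ) = p ∧ ((a : ℤ), (c : ℤ)) ∈ Lam p μ ∧
      (-(d : ℤ), (b : ℤ)) ∈ Lam p μ := by
  obtain ⟨hu, hv, hD⟩ := lam_basis_mp _ _ _ _ _ _ hcl
  have hp0 : (0 : ℤ) < p := by exact_mod_cast hp.pos
  have ha : (1 : ℤ) ≤ a := by omega
  have hb : (1 : ℤ) ≤ b := by omega
  have hab : (0 : ℤ) < a * b := by positivity
  have hcd : (0 : ℤ) ≤ c * d := by positivity
  have hD : (a * b + c * d : ℤ) = p := by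
    rcases hD with hD | hD
    · linarith
    · nlinarith
  refine ⟨?_, ?_, hD, hu, hv⟩
  · rcases Nat.eq_zero_or_pos c with rfl | h0
    · exfalso
      rw [lam_mem] at hu hv
      simp only [Nat.cast_zero, mul_zero, add_zero, zero_mul] at hu hD
      have := Int.le_of_dvd (by omega) hu
      have hb1 : b = 1 := by
        by_contra hne
        have : (2 : ℤ) ≤ b := by omega
        nlinarith
      have hd0 : d = 0 := by omega
      subst hb1 hd0
      simp at hv
      have := Int.le_of_dvd (by omega) hv
      omega
    · exact_mod_cast h0
  · rcases Nat.eq_zero_or_pos d with rfl | h0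
    · exfalso
      rw [lam_mem] at hu hv
      simp only [Nat.cast_zero, mul_zero, add_zero, zero_add, neg_zero] at hv hD
      have : (p : ℤ) ≤ b := by
        rcases (Nat.prime_iff_prime_int.mp hp).dvd_or_dvd hv with h | h
        · have := Int.le_of_dvd (by omega) h; omega
        · exact Int.le_of_dvd (by omega) h
      have ha1 : a = 1 := by
        by_contra hne
        have : (2 : ℤ) ≤ a := by omega
        nlinarith
      have hc0 : c = 0 := by omega
      subst ha1 hc0
      simp only [Nat.cast_one, Nat.cast_zero, mul_zero, add_zero] at hu
      have := Int.le_of_dvd (by norm_num) hu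
      have := hp.two_le
      omega
    · exact_mod_cast h0

theorem black_start (p : ℕ) (μ : ℤ) (h : HasBlackBasis (Lam p μ)) (hp : p.Prime) :
    ∃ a b c d : ℤ, 0 < c ∧ c < a ∧ 0 < d ∧ d < b ∧ a * b + c * d = p ∧
      (a, c) ∈ Lam p μ ∧ (-d, b) ∈ Lam p μ := by
  obtain ⟨⟨x, y⟩, ⟨z, w⟩, hcl, hmono⟩ := h
  obtain ⟨hu, hv, hD⟩ := lam_basis_mp _ _ _ _ _ _ hcl
  have hp0 : (0 : ℤ) < p := by exact_mod_cast hp.pos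
  obtain ⟨⟨a, c⟩, hm0, h0⟩ := hmono 0
  obtain ⟨⟨d, b⟩, hm1, h1⟩ := hmono 1
  simp only [Black, Matrix.cons_val_zero, Matrix.cons_val_one] at h0 h1
  obtain ⟨h01, h02⟩ := h0
  obtain ⟨h11, h12⟩ := h1
  simp only [Set.mem_insert_iff, Set.mem_singleton_iff, Prod.neg_mk, Prod.mk.injEq] at hm0 hm1
  have hu' := neg_mem hu
  have hv' := neg_mem hv
  rw [Prod.neg_mk] at hu' hv'
  have k1 : (a, c) ∈ Lam p μ := by
    rcases hm0 with ⟨rfl, rfl⟩ | ⟨rfl, rfl⟩ | ⟨rfl, rfl⟩ | ⟨rfl, rfl⟩ <;> assumption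
  have k2 : (d, b) ∈ Lam p μ := by
    rcases hm1 with ⟨rfl, rfl⟩ | ⟨rfl, rfl⟩ | ⟨rfl, rfl⟩ | ⟨rfl, rfl⟩ <;> assumption
  have hpos : 0 < a * b + c * (-d) := by
    have := mul_pos (show 0 < a by omega) (show 0 < b by omega)
    have := mul_pos h01 h11
    omega
  refine ⟨a, b, c, -d, h01, h02, h11, h12, ?_, k1, by simpa using k2⟩
  have key : a * b + c * (-d) = p ∨ a * b + c * (-d) = -p := by
    rcases hm0 with ⟨rfl, rfl⟩ | ⟨rfl, rfl⟩ | ⟨rfl, rfl⟩ | ⟨rfl, rfl⟩ <;>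
    rcases hm1 with ⟨rfl, rfl⟩ | ⟨rfl, rfl⟩ | ⟨rfl, rfl⟩ | ⟨rfl, rfl⟩ <;>
    first
    | (exfalso; omega)
    | (rcases hD with hD | hD
       · first
         | (left; linarith)
         | (right; linarith)
       · first
         | (left; linarith)
         | (right; linarith))
  omega

theorem red_uniq (p : ℕ) (hp0 : (0 : ℤ) < p) (μ : ℤ) (a b c d a' b' c' d' : ℤ)
    (hc : 0 < c) (hd : 0 < d) (h1 : c < a) (h2 : d < a) (h3 : c < b) (h4 : d < b)
    (hc' : 0 < c') (hd' : 0 < d') (h1' : c' < a') (h2' : d' < a') (h3' : c' < b') (h4' : d' < b')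
    (hD : a * b + c * d = p) (hD' : a' * b' + c' * d' = p)
    (hu : (a, c) ∈ Lam p μ) (hv : (-d, b) ∈ Lam p μ)
    (hu' : (a', c') ∈ Lam p μ) (hv' : (-d', b') ∈ Lam p μ) :
    a' = a ∧ b' = b ∧ c' = c ∧ d' = d := by
  have hpn : (p : ℤ) ≠ 0 := hp0.ne'
  obtain ⟨m, hm⟩ := lam_det _ _ _ _ _ _ hu' hv
  obtain ⟨n, hn⟩ := lam_det _ _ _ _ _ _ hu hu'
  obtain ⟨l, hl⟩ := lam_det _ _ _ _ _ _ hu hv'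
  obtain ⟨k, hk⟩ := lam_det _ _ _ _ _ _ hv' hv
  have e1 : a' = m * a - n * d := by
    apply mul_left_cancel₀ hpn
    linear_combination a * hm - d * hn - a' * hD
  have e2 : c' = m * c + n * b := by
    apply mul_left_cancel₀ hpn
    linear_combination c * hm + b * hn - c' * hD
  have e3 : -d' = k * a - l * d := by
    apply mul_left_cancel₀ hpn
    linear_combination a * hk - d * hl + d' * hD
  have e4 : b' = k * c + l * b := by
    apply mul_left_cancel₀ hpn
    linear_combination c * hk + b * hl - b' * hD
  have hdet : m * l - n * k = 1 := by
    apply mul_left_cancel₀ hpn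
    have : a' * b' - c' * (-d') = (m * l - n * k) * (a * b + c * d) := by
      rw [e1, e2, e3, e4]; ring
    rw [hD] at this
    linear_combination hD' - this
  have hm1 : 1 ≤ m := by
    have : 0 < p * m := by rw [← hm]; nlinarith [mul_pos (show 0 < a' by omega) (show 0 < b by omega), mul_pos hc' hd]
    exact pos_of_mul_pos_right this hp0.le
  have hl1 : 1 ≤ l := by
    have : 0 < p * l := by rw [← hl]; nlinarith [mul_pos (show 0 < a by omega) (show 0 < b' by omega), mul_pos hc hd']
    exact pos_of_mul_pos_right this hp0.le
  rcases lt_trichotomy n 0 with hn0 | hn0 | hn0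
  · exfalso
    refine core_uniq a' b' c' d' a b c d l (-n) (-k) m hc' hd' h1' h2' h3' h4' hc hd h1 h2 h3 h4
      ?_ ?_ ?_ ?_ ?_ (by omega) hl1 hm1
    · linear_combination (-l) * e1 + n * e3 - a * hdet
    · linear_combination (-l) * e2 + n * e4 - c * hdet
    · linear_combination k * e1 - m * e3 + d * hdet
    · linear_combination k * e2 - m * e4 - b * hdet
    · linear_combination hdet
  · subst hn0
    have hml : m = 1 ∧ l = 1 := by
      constructor <;> nlinarith
    obtain ⟨rfl, rfl⟩ := hml
    have hk0 : k = 0 := by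
      rcases lt_trichotomy k 0 with h | h | h
      · exfalso; nlinarith
      · exact h
      · exfalso; nlinarith
    subst hk0
    refine ⟨?_, ?_, ?_, ?_⟩ <;> linarith
  · exfalso
    exact core_uniq a b c d a' b' c' d' m n k l hc hd h1 h2 h3 h4 hc' hd' h1' h2' h3' h4'
      e1 e2 e3 e4 hdet hn0 hm1 hl1

theorem stmt10 (p : ℕ) (hp : p.Prime) (hodd : Odd p)
    (μ : ℤ) (hμ₁ : 2 ≤ μ) (hμ₂ : μ ≤ (p : ℤ) - 2) :
    (¬ HasBlackBasis (Lam p μ)) ∨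
      ∃! q : ℕ × ℕ × ℕ × ℕ, max q.2.2.1 q.2.2.2 < min q.1 q.2.1 ∧
        AddSubgroup.closure
          ({((q.1 : ℤ), (q.2.2.1 : ℤ)), (-(q.2.2.2 : ℤ), (q.2.1 : ℤ))} : Set (ℤ × ℤ)) =
          Lam p μ := by
  by_cases hB : HasBlackBasis (Lam p μ)
  swap
  · exact Or.inl hB
  right
  obtain ⟨a, b, c, d, h1, h2, h3, h4, h5, h6, h7⟩ := black_start p μ hB hp
  obtain ⟨a, b, c, d, hc, hd, h1, h2, h3, h4, hD, hu, hv⟩ :=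
    core_descent p hp μ hμ₁ hμ₂ (c + d).toNat a b c d h1 h2 h3 h4 (by omega) h5 h6 h7
  lift a to ℕ using by omega
  lift b to ℕ using by omega
  lift c to ℕ using by omega
  lift d to ℕ using by omega
  refine ⟨(a, b, c, d), ⟨by simp only; omega, ?_⟩, ?_⟩
  · exact lam_basis_mpr p hp.ne_zero μ _ _ _ _ hu hv (by linarith)
  · rintro ⟨a', b', c', d'⟩ ⟨hlt, hcl⟩
    simp only at hlt hcl
    obtain ⟨hc', hd', hD', hu', hv'⟩ := red_pos p hp μ hμ₁ hμ₂ a' b' c' d' hlt hcl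
    have := red_uniq p (by exact_mod_cast hp.pos) μ a b c d a' b' c' d' hc hd h1 h2 h3 h4 hc' hd'
      (by omega) (by omega) (by omega) (by omega) hD hD' hu hv hu' hv'
    simp only [Prod.mk.injEq]
    omega
end

section
/- Let p be an odd prime and let μ, μ' be integers with 2 ≤ μ, μ' ≤ p−2 and μ·μ' ≡ 1 (mod p). The reflection (x,y) ↦ (y,x) maps Λ_μ(p) bijectively onto Λ_{μ'}(p), and consequently Λ_μ(p) has a black monochromatic basis if and only if Λ_{μ'}(p) has a white monochromatic basis. -/
theorem mono_swap {C D : Fin 4 → (ℤ × ℤ) → Prop} (hCD : ∀ i v, C i v → D i v.swap)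
    {M N : AddSubgroup (ℤ × ℤ)} (hMN : ∀ v, v ∈ N ↔ v.swap ∈ M) {b₁ b₂ : ℤ × ℤ}
    (h : IsMonoBasis C M b₁ b₂) : IsMonoBasis D N b₁.swap b₂.swap := by
  obtain ⟨h1, h2⟩ := h
  refine ⟨?_, fun i => ?_⟩
  · let s : (ℤ × ℤ) →+ (ℤ × ℤ) := (AddEquiv.prodComm : (ℤ × ℤ) ≃+ (ℤ × ℤ)).toAddMonoidHom
    have hs : ∀ v, s v = v.swap := fun v => rfl
    have hN : N = M.map s := by
      ext v
      rw [hMN, AddSubgroup.mem_map]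
      constructor
      · intro hv
        exact ⟨v.swap, hv, by rw [hs, Prod.swap_swap]⟩
      · rintro ⟨w, hw, rfl⟩
        rwa [hs, Prod.swap_swap]
    rw [hN, ← h1, AddMonoidHom.map_closure, Set.image_pair, hs, hs]
  · obtain ⟨v, hv, hc⟩ := h2 i
    refine ⟨v.swap, ?_, hCD i v hc⟩
    simp only [Set.mem_insert_iff, Set.mem_singleton_iff] at hv ⊢
    rcases hv with rfl | rfl | rfl | rfl
    · exact Or.inl rfl
    · exact Or.inr (Or.inl rfl)
    · exact Or.inr (Or.inr (Or.inl rfl))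
    · exact Or.inr (Or.inr (Or.inr rfl))

theorem lam_swap (p : ℕ) (μ μ' : ℤ) (hinv : (p : ℤ) ∣ μ * μ' - 1) (v : ℤ × ℤ)
    (hv : v ∈ Lam p μ) : v.swap ∈ Lam p μ' := by
  obtain ⟨k, hk⟩ := hinv
  obtain ⟨l, hl⟩ := (show (p : ℤ) ∣ v.1 + μ * v.2 from hv)
  show (p : ℤ) ∣ v.2 + μ' * v.1
  exact ⟨μ' * l - k * v.2, by linear_combination μ' * hl - v.2 * hk⟩

/-- If `μ·μ' ≡ 1 (mod p)` then the reflection `(x,y) ↦ (y,x)` maps `Λ_μ(p)`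
bijectively onto `Λ_{μ'}(p)`; consequently `Λ_μ(p)` has a black monochromatic basis
iff `Λ_{μ'}(p)` has a white one. -/
theorem stmt12 (p : ℕ) (hp : p.Prime) (hodd : Odd p)
    (μ μ' : ℤ) (hμ₁ : 2 ≤ μ) (hμ₂ : μ ≤ (p : ℤ) - 2)
    (hμ'₁ : 2 ≤ μ') (hμ'₂ : μ' ≤ (p : ℤ) - 2)
    (hinv : (p : ℤ) ∣ μ * μ' - 1) :
    ((fun v : ℤ × ℤ => (v.2, v.1)) '' (Lam p μ : Set (ℤ × ℤ)) =
        (Lam p μ' : Set (ℤ × ℤ))) ∧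
      (HasBlackBasis (Lam p μ) ↔ HasWhiteBasis (Lam p μ')) := by
  have hinv' : (p : ℤ) ∣ μ' * μ - 1 := by rwa [mul_comm]
  have h1 := lam_swap p μ μ' hinv
  have h2 := lam_swap p μ' μ hinv'
  refine ⟨?_, ?_, ?_⟩
  · ext v
    constructor
    · rintro ⟨w, hw, rfl⟩
      exact h1 w hw
    · intro hv
      exact ⟨v.swap, h2 v hv, rfl⟩
  · rintro ⟨b₁, b₂, h⟩
    exact ⟨_, _, mono_swap (fun i v hc => hc) (fun v => ⟨h2 v, h1 v.swap⟩) h⟩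
  · rintro ⟨b₁, b₂, h⟩
    exact ⟨_, _, mono_swap (fun i v hc => hc) (fun v => ⟨h1 v, h2 v.swap⟩) h⟩
end

section
/- For every odd prime p, neither Λ_1(p) = {(x,y) ∈ ℤ² : x + y ≡ 0 (mod p)} nor Λ_{p−1}(p) = {(x,y) ∈ ℤ² : x − y ≡ 0 (mod p)} has a monochromatic basis (black or white). -/
lemma core1 (a b c d m n : ℤ) (hb : 0 < b) (hba : b < a) (hc : 0 < c) (hcd : c < d)
    (h1 : m * a - n * c = 1) (h2 : m * b + n * d = 1 ∨ m * b + n * d = -1) : False := by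
  rcases lt_trichotomy m 0 with hm | hm | hm <;> rcases lt_trichotomy n 0 with hn | hn | hn
  · rcases h2 with h2 | h2 <;> nlinarith
  · subst hn; nlinarith
  · nlinarith
  · subst hm; rcases h2 with h2 | h2 <;> nlinarith
  · subst hm; subst hn; simp at h1
  · subst hm; nlinarith
  · nlinarith
  · subst hn; nlinarith
  · rcases h2 with h2 | h2 <;> nlinarith

lemma core2 (a b c d m n : ℤ) (hb : 0 < b) (hba : b < a) (hc : 0 < c) (hcd : c < d)
    (h1 : m * a - n * c = 1 ∨ m * a - n * c = -1)
    (h2 : m * b + n * d = 1 ∨ m * b + n * d = -1) : False := by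
  rcases h1 with h1 | h1
  · exact core1 a b c d m n hb hba hc hcd h1 h2
  · refine core1 a b c d (-m) (-n) hb hba hc hcd (by linarith) ?_
    rcases h2 with h2 | h2
    · right; linarith
    · left; linarith

lemma span_aux (b₁ b₂ u v w : ℤ × ℤ) (hu : u ∈ ({b₁, -b₁, b₂, -b₂} : Set (ℤ × ℤ)))
    (hv : v ∈ ({b₁, -b₁, b₂, -b₂} : Set (ℤ × ℤ))) (h1 : v ≠ u) (h2 : v ≠ -u)
    (hw : w ∈ AddSubgroup.closure {b₁, b₂}) :
    ∃ m n : ℤ, m * u.1 + n * v.1 = w.1 ∧ m * u.2 + n * v.2 = w.2 := by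
  obtain ⟨m, n, rfl⟩ := AddSubgroup.mem_closure_pair.1 hw
  simp only [Set.mem_insert_iff, Set.mem_singleton_iff] at hu hv
  rcases hu with rfl | rfl | rfl | rfl <;> rcases hv with rfl | rfl | rfl | rfl <;>
    first
    | exact absurd rfl h1
    | exact absurd rfl h2
    | exact absurd (neg_neg _).symm h2
    | (refine ⟨m, n, ?_, ?_⟩ <;> simp [add_comm]; done)
    | (refine ⟨m, -n, ?_, ?_⟩ <;> simp [add_comm]; done)
    | (refine ⟨-m, n, ?_, ?_⟩ <;> simp [add_comm]; done)
    | (refine ⟨-m, -n, ?_, ?_⟩ <;> simp [add_comm]; done)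
    | (refine ⟨n, m, ?_, ?_⟩ <;> simp [add_comm]; done)
    | (refine ⟨n, -m, ?_, ?_⟩ <;> simp [add_comm]; done)
    | (refine ⟨-n, m, ?_, ?_⟩ <;> simp [add_comm]; done)
    | (refine ⟨-n, -m, ?_, ?_⟩ <;> simp [add_comm]; done)

lemma no_black (M : AddSubgroup (ℤ × ℤ)) (e : ℤ) (he : e = 1 ∨ e = -1)
    (hM : ((1, e) : ℤ × ℤ) ∈ M) : ¬ HasBlackBasis M := by
  rintro ⟨b₁, b₂, rfl, h⟩
  obtain ⟨u, hu, hu'⟩ := h 0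
  obtain ⟨v, hv, hv'⟩ := h 1
  simp only [Black, Matrix.cons_val] at hu' hv'
  obtain ⟨m, n, h1, h2⟩ := span_aux b₁ b₂ u v _ hu hv
    (by rintro rfl; omega) (by rintro rfl; simp at hv'; omega) hM
  exact core2 u.1 u.2 (-v.1) v.2 m n hu'.1 hu'.2 hv'.1 hv'.2
    (by left; linarith) (by rw [h2]; exact he)

lemma no_white (M : AddSubgroup (ℤ × ℤ)) (e : ℤ) (he : e = 1 ∨ e = -1)
    (hM : ((1, e) : ℤ × ℤ) ∈ M) : ¬ HasWhiteBasis M := by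
  rintro ⟨b₁, b₂, rfl, h⟩
  obtain ⟨u, hu, hu'⟩ := h 0
  obtain ⟨v, hv, hv'⟩ := h 1
  simp only [White, Black, Matrix.cons_val] at hu' hv'
  obtain ⟨m, n, h1, h2⟩ := span_aux b₁ b₂ u v _ hu hv
    (by rintro rfl; omega) (by rintro rfl; simp at hv'; omega) hM
  simp only at h1 h2
  refine core2 u.2 u.1 (-v.2) v.1 m n hu'.1 hu'.2 hv'.1 hv'.2 ?_ (by left; exact h1)
  rw [← h2] at he
  simpa using he

/-- For every odd prime `p`, neither `Λ_1(p)` nor `Λ_{p−1}(p)` has a monochromatic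
basis (black or white). -/
theorem stmt13 (p : ℕ) (hp : p.Prime) (hodd : Odd p) :
    (¬ HasBlackBasis (Lam p 1) ∧ ¬ HasWhiteBasis (Lam p 1)) ∧
      (¬ HasBlackBasis (Lam p ((p : ℤ) - 1)) ∧ ¬ HasWhiteBasis (Lam p ((p : ℤ) - 1))) := by
  have h1 : ((1, -1) : ℤ × ℤ) ∈ Lam p 1 := by
    change (p : ℤ) ∣ 1 + 1 * (-1)
    simp
  have h2 : ((1, 1) : ℤ × ℤ) ∈ Lam p ((p : ℤ) - 1) := by
    change (p : ℤ) ∣ 1 + ((p : ℤ) - 1) * 1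
    simp
  exact ⟨⟨no_black _ _ (Or.inr rfl) h1, no_white _ _ (Or.inr rfl) h1⟩,
    no_black _ _ (Or.inl rfl) h2, no_white _ _ (Or.inl rfl) h2⟩
end

section
/- Let p be an odd prime, let μ be an integer with 2 ≤ μ ≤ p−2, and let w be a nonzero element of Λ_μ(p) of minimal Euclidean norm. Then Λ_μ(p) has a monochromatic basis (black or white) one of whose two elements is either w itself, or an element of minimal Euclidean norm among the nonzero elements of Λ_μ(p) ∖ ℤw. -/
def GoodP (a b c d : ℤ) : Prop :=
  (a * b) * (c * d) < 0 ∧ (a ^ 2 - b ^ 2) * (c ^ 2 - d ^ 2) < 0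

def Conc (a b c d : ℤ) : Prop :=
  GoodP a b c d ∨ GoodP a b (c - a) (d - b) ∨ GoodP a b (c + a) (d + b) ∨
    GoodP c d (c - a) (d - b) ∨ GoodP c d (c + a) (d + b)

def NZ (x y : ℤ) : Prop := x * y ≠ 0 ∧ x ^ 2 - y ^ 2 ≠ 0

def Hyp (a b c d : ℤ) : Prop :=
  NZ a b ∧ NZ c d ∧ NZ (c - a) (d - b) ∧ NZ (c + a) (d + b) ∧
  a ^ 2 + b ^ 2 ≤ c ^ 2 + d ^ 2 ∧
  c ^ 2 + d ^ 2 ≤ (c - a) ^ 2 + (d - b) ^ 2 ∧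
  c ^ 2 + d ^ 2 ≤ (c + a) ^ 2 + (d + b) ^ 2

lemma f_pos {x y : ℤ} (hx : 0 < x) (hy : 0 < y) : 0 < x * y := mul_pos hx hy

/-- sign criteria -/
lemma good1 {a b c d : ℤ} (hb : 0 < b) (hab : b < a) (hc : c < 0) (hd : -c < d) :
    GoodP a b c d := by
  refine ⟨mul_neg_of_pos_of_neg (by nlinarith) (by nlinarith),
    mul_neg_of_pos_of_neg (by nlinarith) (by nlinarith)⟩

lemma good2 {a b c d : ℤ} (ha : 0 < a) (hab : a < b) (hd : 0 < d) (hc : d < -c) :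
    GoodP a b c d := by
  refine ⟨mul_neg_of_pos_of_neg (by nlinarith) (by nlinarith),
    mul_neg_of_neg_of_pos (by nlinarith) (by nlinarith)⟩

lemma good_comm {a b c d : ℤ} (h : GoodP a b c d) : GoodP c d a b := by
  unfold GoodP at *
  rw [mul_comm (c * d), mul_comm (c ^ 2 - d ^ 2)]; exact h

lemma NZ.ne {x y : ℤ} (h : NZ x y) : x ≠ 0 ∧ y ≠ 0 ∧ x ≠ y ∧ x ≠ -y := by
  obtain ⟨h1, h2⟩ := h
  refine ⟨?_, ?_, ?_, ?_⟩ <;> rintro rfl <;> simp at h1 h2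

lemma core {a b c d : ℤ} (h : Hyp a b c d) (hb : 0 < b) (hab : b < a) (hd : 0 < d) :
    Conc a b c d := by
  obtain ⟨n1, n2, n3, n4, h1, h2, h3⟩ := h
  obtain ⟨e1, e2, e3, e4⟩ := n2.ne
  obtain ⟨f1, f2, f3, f4⟩ := n3.ne
  obtain ⟨g1, g2, g3, g4⟩ := n4.ne
  rcases lt_or_gt_of_ne e1 with hc | hc
  · rcases lt_or_gt_of_ne e4 with hcd | hcd
    · -- c < -d
      rcases lt_or_gt_of_ne g1 with hx | hx
      · refine Or.inr (Or.inr (Or.inl (good1 hb hab hx ?_)))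
        by_contra hcon
        push Not at hcon
        nlinarith [mul_le_mul_of_nonneg_left hcon (show 0 ≤ a by omega), mul_pos hb hd,
          mul_pos (show 0 < a - b by omega) hd, mul_pos (show 0 < a - b by omega) hb]
      · refine Or.inr (Or.inr (Or.inr (Or.inr (good_comm (good2 hx ?_ hd (by omega))))))
        by_contra hcon
        push Not at hcon
        nlinarith
    · exact Or.inl (good1 hb hab hc (by omega))
  · rcases lt_or_gt_of_ne e3 with hcd | hcd
    · -- 0 < c < d
      have hdb : b < d := by
        by_contra hcon
        push Not at hcon
        nlinarith
      have hca : c < a := by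
        by_contra hcon
        push Not at hcon
        nlinarith
      rcases lt_or_gt_of_ne f4 with hx | hx
      · refine Or.inr (Or.inr (Or.inr (Or.inl (good2 hc hcd (by omega) (by omega)))))
      · exact Or.inr (Or.inl (good1 hb hab (by omega) (by omega)))
    · exfalso
      have k1 : 2 * (a * c) < a ^ 2 + b ^ 2 := by nlinarith [mul_pos hb hd]
      have k2 : a ^ 2 + b ^ 2 < 2 * c ^ 2 := by nlinarith
      have k3 : a ^ 2 + b ^ 2 < 2 * a ^ 2 := by nlinarith
      have ha : 0 < a := by omega
      have : c < a := by nlinarith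
      have := mul_lt_mul_of_pos_right this hc
      linarith [sq c]

lemma core2_s15 {a b c d : ℤ} (h : Hyp a b c d) (hb : 0 < b) (hab : b < a) :
    Conc a b c d := by
  rcases lt_or_gt_of_ne (h.2.1.ne.2.1) with hd | hd
  · have : Conc a b (-c) (-d) := by
      apply core _ hb hab (by omega)
      simp only [Hyp, NZ] at h ⊢
      obtain ⟨⟨p1, q1⟩, ⟨p2, q2⟩, ⟨p3, q3⟩, ⟨p4, q4⟩, h1, h2, h3⟩ := h
      refine ⟨⟨p1, q1⟩, ⟨?_, ?_⟩, ⟨?_, ?_⟩, ⟨?_, ?_⟩, ?_, ?_, ?_⟩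
      · ring_nf at p2 ⊢; exact p2
      · ring_nf at q2 ⊢; exact q2
      · ring_nf at p4 ⊢; exact p4
      · ring_nf at q4 ⊢; exact q4
      · ring_nf at p3 ⊢; exact p3
      · ring_nf at q3 ⊢; exact q3
      · linarith
      · linarith
      · linarith
    simp only [Conc, GoodP] at this ⊢
    rcases this with ⟨h1, h2⟩ | ⟨h1, h2⟩ | ⟨h1, h2⟩ | ⟨h1, h2⟩ | ⟨h1, h2⟩
    · exact Or.inl ⟨by linarith, by linarith⟩
    · exact Or.inr (Or.inr (Or.inl ⟨by linarith, by linarith⟩))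
    · exact Or.inr (Or.inl ⟨by linarith, by linarith⟩)
    · exact Or.inr (Or.inr (Or.inr (Or.inr ⟨by linarith, by linarith⟩)))
    · exact Or.inr (Or.inr (Or.inr (Or.inl ⟨by linarith, by linarith⟩)))
  · exact core h hb hab hd

lemma nz_negy {x y : ℤ} : NZ x (-y) ↔ NZ x y := by simp [NZ]
lemma nz_swap {x y : ℤ} : NZ y x ↔ NZ x y := by
  unfold NZ
  rw [mul_comm y x, ← neg_sub (x ^ 2) (y ^ 2), neg_ne_zero]
lemma good_negy {a b c d : ℤ} : GoodP a (-b) c (-d) ↔ GoodP a b c d := by simp [GoodP]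
lemma good_swap {a b c d : ℤ} : GoodP b a d c ↔ GoodP a b c d := by
  unfold GoodP
  rw [mul_comm b a, mul_comm d c, ← neg_sub (a ^ 2) (b ^ 2), ← neg_sub (c ^ 2) (d ^ 2), neg_mul_neg]

lemma hyp_negy {a b c d : ℤ} (h : Hyp a b c d) : Hyp a (-b) c (-d) := by
  have e1 : -d - -b = -(d - b) := by ring
  have e2 : -d + -b = -(d + b) := by ring
  unfold Hyp at *
  simpa only [e1, e2, nz_negy, neg_sq] using h
lemma conc_negy {a b c d : ℤ} (h : Conc a (-b) c (-d)) : Conc a b c d := by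
  have e1 : -d - -b = -(d - b) := by ring
  have e2 : -d + -b = -(d + b) := by ring
  unfold Conc at *
  simpa only [e1, e2, good_negy] using h
lemma hyp_swap {a b c d : ℤ} (h : Hyp a b c d) : Hyp b a d c := by
  unfold Hyp at *
  obtain ⟨n1, n2, n3, n4, h1, h2, h3⟩ := h
  exact ⟨nz_swap.1 n1, nz_swap.1 n2, nz_swap.1 n3, nz_swap.1 n4, by linarith, by linarith,
    by linarith⟩
lemma conc_swap {a b c d : ℤ} (h : Conc b a d c) : Conc a b c d := by
  unfold Conc at *
  simpa only [good_swap] using h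

lemma core3 {a b c d : ℤ} (h : Hyp a b c d) (ha : 0 < a) (hb : 0 < b) : Conc a b c d := by
  rcases lt_or_gt_of_ne (h.1.ne.2.2.1) with hd | hd
  · exact conc_swap (core2_s15 (hyp_swap h) ha hd)
  · exact core2_s15 h hb hd
lemma core4 {a b c d : ℤ} (h : Hyp a b c d) (ha : 0 < a) : Conc a b c d := by
  rcases lt_or_gt_of_ne (h.1.ne.2.1) with hd | hd
  · exact conc_negy (core3 (hyp_negy h) ha (by omega))
  · exact core3 h ha hd
lemma core5 {a b c d : ℤ} (h : Hyp a b c d) : Conc a b c d := by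
  rcases lt_or_gt_of_ne (h.1.ne.1) with hd | hd
  · apply conc_swap
    apply conc_negy
    apply conc_swap
    exact core4 (hyp_swap (hyp_negy (hyp_swap h))) (by omega)
  · exact core4 h hd

lemma cone02 {x y : ℤ} (hf : 0 < x * y) (hg : 0 < x ^ 2 - y ^ 2) :
    (Black 0 (x, y) ∧ Black 2 (-(x, y))) ∨ (Black 0 (-(x, y)) ∧ Black 2 (x, y)) := by
  simp only [Black, Matrix.cons_val, Prod.neg_mk]
  rcases pos_and_pos_or_neg_and_neg_of_mul_pos hf with ⟨h1, h2⟩ | ⟨h1, h2⟩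
  · have : y < x := by nlinarith
    left; omega
  · have : x < y := by nlinarith
    right; omega

lemma cone13 {x y : ℤ} (hf : x * y < 0) (hg : x ^ 2 - y ^ 2 < 0) :
    (Black 1 (x, y) ∧ Black 3 (-(x, y))) ∨ (Black 1 (-(x, y)) ∧ Black 3 (x, y)) := by
  simp only [Black, Matrix.cons_val, Prod.neg_mk]
  rcases mul_neg_iff.1 hf with ⟨h1, h2⟩ | ⟨h1, h2⟩
  · have : x < -y := by nlinarith
    right; omega
  · have : -x < y := by nlinarith
    left; omega

lemma black_all {b₁ b₂ : ℤ × ℤ} (h1 : 0 < b₁.1 * b₁.2) (h2 : 0 < b₁.1 ^ 2 - b₁.2 ^ 2)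
    (h3 : b₂.1 * b₂.2 < 0) (h4 : b₂.1 ^ 2 - b₂.2 ^ 2 < 0) :
    ∀ i : Fin 4, ∃ v ∈ ({b₁, -b₁, b₂, -b₂} : Set (ℤ × ℤ)), Black i v := by
  have A := cone02 h1 h2
  have B := cone13 h3 h4
  simp only [Prod.mk.eta] at A B
  intro i
  simp only [Set.mem_insert_iff, Set.mem_singleton_iff, exists_eq_or_imp, exists_eq_left]
  fin_cases i <;> simp <;> tauto

lemma white_all {b₁ b₂ : ℤ × ℤ} (h1 : 0 < b₁.1 * b₁.2) (h2 : b₁.1 ^ 2 - b₁.2 ^ 2 < 0)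
    (h3 : b₂.1 * b₂.2 < 0) (h4 : 0 < b₂.1 ^ 2 - b₂.2 ^ 2) :
    ∀ i : Fin 4, ∃ v ∈ ({b₁, -b₁, b₂, -b₂} : Set (ℤ × ℤ)), White i v := by
  have A := cone02 (x := b₁.2) (y := b₁.1) (by linarith) (by linarith)
  have B := cone13 (x := b₂.2) (y := b₂.1) (by linarith) (by linarith)
  intro i
  simp only [Set.mem_insert_iff, Set.mem_singleton_iff, exists_eq_or_imp, exists_eq_left, White,
    Prod.fst_neg, Prod.snd_neg]
  simp only [Prod.neg_mk] at A B
  fin_cases i <;> simp <;> tauto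

lemma good_mono {M : AddSubgroup (ℤ × ℤ)} {b₁ b₂ : ℤ × ℤ}
    (hM : AddSubgroup.closure {b₁, b₂} = M) (h : GoodP b₁.1 b₁.2 b₂.1 b₂.2) :
    IsMonoBasis Black M b₁ b₂ ∨ IsMonoBasis White M b₁ b₂ := by
  have hsw : ({b₂, -b₂, b₁, -b₁} : Set (ℤ × ℤ)) = {b₁, -b₁, b₂, -b₂} := by
    ext v; simp only [Set.mem_insert_iff, Set.mem_singleton_iff]; tauto
  obtain ⟨hf, hg⟩ := h
  rcases mul_neg_iff.1 hf with ⟨h1, h2⟩ | ⟨h1, h2⟩ <;>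
    rcases mul_neg_iff.1 hg with ⟨h3, h4⟩ | ⟨h3, h4⟩
  · exact Or.inl ⟨hM, black_all h1 h3 h2 h4⟩
  · exact Or.inr ⟨hM, white_all h1 h3 h2 h4⟩
  · exact Or.inr ⟨hM, hsw ▸ white_all h2 h4 h1 h3⟩
  · exact Or.inl ⟨hM, hsw ▸ black_all h2 h4 h1 h3⟩

lemma clos {M : AddSubgroup (ℤ × ℤ)} {w u b₁ b₂ : ℤ × ℤ}
    (hM : AddSubgroup.closure {w, u} = M) (h1 : b₁ ∈ M) (h2 : b₂ ∈ M)
    (h3 : ∃ m n : ℤ, w = m • b₁ + n • b₂) (h4 : ∃ m n : ℤ, u = m • b₁ + n • b₂) :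
    AddSubgroup.closure {b₁, b₂} = M := by
  apply le_antisymm
  · rw [AddSubgroup.closure_le]
    rintro v (rfl | rfl)
    · exact h1
    · exact h2
  · rw [← hM, AddSubgroup.closure_le]
    rintro v (rfl | rfl)
    · exact AddSubgroup.mem_closure_pair.2 (by obtain ⟨m, n, e⟩ := h3; exact ⟨m, n, e.symm⟩)
    · exact AddSubgroup.mem_closure_pair.2 (by obtain ⟨m, n, e⟩ := h4; exact ⟨m, n, e.symm⟩)

lemma near (x D : ℤ) (hD : D ≠ 0) : ∃ m r : ℤ, x = D * m + r ∧ 4 * r ^ 2 ≤ D ^ 2 := by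
  have hpos : 0 < |D| := abs_pos.2 hD
  have key : ∃ m r : ℤ, x = |D| * m + r ∧ 2 * r ≤ |D| ∧ - |D| ≤ 2 * r := by
    have e := Int.emod_add_mul_ediv x |D|
    have l := Int.emod_nonneg x hpos.ne'
    have l2 := Int.emod_lt_of_pos x hpos
    by_cases h : 2 * (x % |D|) ≤ |D|
    · exact ⟨x / |D|, x % |D|, by linarith, h, by linarith⟩
    · exact ⟨x / |D| + 1, x % |D| - |D|, by linarith, by linarith, by linarith⟩
  obtain ⟨m, r, e, h1, h2⟩ := key
  have hr : 4 * r ^ 2 ≤ D ^ 2 := by rw [← sq_abs D]; nlinarith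
  rcases abs_choice D with h | h
  · exact ⟨m, r, by rw [e, h], hr⟩
  · exact ⟨-m, r, by rw [e, h]; ring, hr⟩

/-- nonzero vectors on the walls are long -/
lemma lam_nz {p : ℕ} (hp : p.Prime) {μ : ℤ} (hμ₁ : 2 ≤ μ) (hμ₂ : μ ≤ (p : ℤ) - 2)
    {v : ℤ × ℤ} (hv : v ∈ Lam p μ) (hv0 : v ≠ 0) (hs : v.1 ^ 2 + v.2 ^ 2 < (p : ℤ) ^ 2) :
    NZ v.1 v.2 := by
  obtain ⟨x, y⟩ := v
  have hd : (p : ℤ) ∣ x + μ * y := hv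
  have hP : Prime (p : ℤ) := Nat.prime_iff_prime_int.1 hp
  simp only at hs ⊢
  have small : ∀ t : ℤ, (p : ℤ) ∣ t → t ^ 2 < (p : ℤ) ^ 2 → t = 0 := by
    intro t h1 h2
    exact Int.eq_zero_of_abs_lt_dvd h1 (by simpa using sq_lt_sq.1 h2)
  have nd : ∀ t : ℤ, 0 < t → t < p → ¬ (p : ℤ) ∣ t := by
    intro t h1 h2 h3
    have := Int.le_of_dvd h1 h3
    omega
  constructor
  · intro h
    rcases mul_eq_zero.1 h with rfl | rfl
    · have : (p : ℤ) ∣ y := by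
        rw [zero_add] at hd
        exact (hP.dvd_or_dvd hd).resolve_left (nd μ (by omega) (by omega))
      exact hv0 (by rw [small y this (by nlinarith)]; rfl)
    · have : (p : ℤ) ∣ x := by simpa using hd
      exact hv0 (by rw [small x this (by nlinarith)]; rfl)
  · intro h
    have h' : (x - y) * (x + y) = 0 := by linarith
    have : x = y ∨ x = -y := by
      rcases mul_eq_zero.1 h' with h | h
      · left; omega
      · right; omega
    rcases this with rfl | rfl
    · have e : x + μ * x = (1 + μ) * x := by ring
      rw [e] at hd
      have := (hP.dvd_or_dvd hd).resolve_left (nd _ (by omega) (by omega))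
      exact hv0 (by rw [small x this (by nlinarith)]; rfl)
    · have e : -y + μ * y = (μ - 1) * y := by ring
      rw [e] at hd
      have := (hP.dvd_or_dvd hd).resolve_left (nd _ (by omega) (by omega))
      exact hv0 (by rw [small y this (by nlinarith)]; rfl)

lemma exists_u (M : AddSubgroup (ℤ × ℤ)) (w : ℤ × ℤ) (h : ∃ v ∈ M, ¬ ∃ n : ℤ, v = n • w) :
    ∃ u ∈ M, (¬ ∃ n : ℤ, u = n • w) ∧ ∀ v ∈ M, (¬ ∃ n : ℤ, v = n • w) →
      u.1 ^ 2 + u.2 ^ 2 ≤ v.1 ^ 2 + v.2 ^ 2 := by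
  obtain ⟨u, ⟨h1, h2⟩, h3⟩ := (measure (fun v : ℤ × ℤ => (v.1 ^ 2 + v.2 ^ 2).toNat)).wf.has_min
    {v | v ∈ M ∧ ¬ ∃ n : ℤ, v = n • w} h
  refine ⟨u, h1, h2, fun v hv hv' => ?_⟩
  have := h3 v ⟨hv, hv'⟩
  have : ¬ ((v.1 ^ 2 + v.2 ^ 2).toNat < (u.1 ^ 2 + u.2 ^ 2).toNat) := this
  have := add_nonneg (sq_nonneg v.1) (sq_nonneg v.2)
  have := add_nonneg (sq_nonneg u.1) (sq_nonneg u.2)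
  omega

lemma normpos {w : ℤ × ℤ} (h : w ≠ 0) : 0 < w.1 ^ 2 + w.2 ^ 2 := by
  by_contra hc
  apply h
  have h1 : w.1 = 0 := by nlinarith [sq_nonneg w.1, sq_nonneg w.2]
  have h2 : w.2 = 0 := by nlinarith [sq_nonneg w.1, sq_nonneg w.2]
  exact Prod.ext h1 h2

/-- the determinant is nonzero -/
lemma det_ne (M : AddSubgroup (ℤ × ℤ)) {w u : ℤ × ℤ} (hw : w ∈ M) (hw0 : w ≠ 0)
    (hmin : ∀ v ∈ M, v ≠ 0 → w.1 ^ 2 + w.2 ^ 2 ≤ v.1 ^ 2 + v.2 ^ 2)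
    (hu : u ∈ M) (hn : ¬ ∃ n : ℤ, u = n • w) : w.1 * u.2 - w.2 * u.1 ≠ 0 := by
  intro h
  have hp := normpos hw0
  obtain ⟨m, r, e, hr⟩ := near (u.1 * w.1 + u.2 * w.2) (w.1 ^ 2 + w.2 ^ 2) hp.ne'
  apply hn
  refine ⟨m, ?_⟩
  by_contra hne
  have := hmin (u - m • w) (M.sub_mem hu (M.zsmul_mem hw m)) (sub_ne_zero.2 hne)
  obtain ⟨a, b⟩ := w
  obtain ⟨c, d⟩ := u
  simp only [Prod.fst_sub, Prod.snd_sub, Prod.smul_fst, Prod.smul_snd, smul_eq_mul] at *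
  have id : ((c - m * a) ^ 2 + (d - m * b) ^ 2) * (a ^ 2 + b ^ 2) =
      r ^ 2 + (a * d - b * c) ^ 2 := by
    have : r = c * a + d * b - (a ^ 2 + b ^ 2) * m := by linarith
    rw [this]; ring
  rw [h] at id
  nlinarith

lemma gen (M : AddSubgroup (ℤ × ℤ)) {w u : ℤ × ℤ} (hw : w ∈ M) (hw0 : w ≠ 0)
    (hmin : ∀ v ∈ M, v ≠ 0 → w.1 ^ 2 + w.2 ^ 2 ≤ v.1 ^ 2 + v.2 ^ 2)
    (hu : u ∈ M) (hn : ¬ ∃ n : ℤ, u = n • w)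
    (humin : ∀ v ∈ M, (¬ ∃ n : ℤ, v = n • w) → u.1 ^ 2 + u.2 ^ 2 ≤ v.1 ^ 2 + v.2 ^ 2) :
    ∀ v ∈ M, ∃ m n : ℤ, v = m • w + n • u := by
  intro v hv
  have hD := det_ne M hw hw0 hmin hu hn
  have hwp := normpos hw0
  have hu0 : u ≠ 0 := by rintro rfl; exact hn ⟨0, by simp⟩
  have hup := normpos hu0
  have hwu := hmin u hu hu0
  obtain ⟨m, r, e1, hr⟩ := near (v.1 * u.2 - v.2 * u.1) _ hD
  obtain ⟨n, s, e2, hs⟩ := near (w.1 * v.2 - w.2 * v.1) _ hD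
  refine ⟨m, n, ?_⟩
  by_contra hne
  have hv' : v - (m • w + n • u) ∈ M :=
    M.sub_mem hv (M.add_mem (M.zsmul_mem hw m) (M.zsmul_mem hu n))
  have hv0 := sub_ne_zero.2 hne
  have k1 := hmin _ hv' hv0
  have k2 := humin _ hv'
  have k3 := det_ne M hw hw0 hmin hv'
  have l1 := humin (u - w) (M.sub_mem hu hw) (by
    rintro ⟨t, ht⟩; exact hn ⟨t + 1, by rw [add_smul, one_smul, ← ht]; abel⟩)
  have l2 := humin (u + w) (M.add_mem hu hw) (by
    rintro ⟨t, ht⟩; exact hn ⟨t - 1, by rw [sub_smul, one_smul, ← ht]; abel⟩)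
  clear hne hv' hv0 hmin humin hn hw hu hv hw0 hu0
  obtain ⟨a, b⟩ := w
  obtain ⟨c, d⟩ := u
  obtain ⟨x, y⟩ := v
  simp only [Prod.fst_sub, Prod.snd_sub, Prod.fst_add, Prod.snd_add, Prod.smul_fst,
    Prod.smul_snd, smul_eq_mul] at *
  set D := a * d - b * c with hDd
  set X := x - (m * a + n * c) with hX
  set Y := y - (m * b + n * d) with hY
  have hr1 : r = X * d - Y * c := by rw [hX, hY]; linear_combination -e1 - (D - a * d + b * c) * m
  have hs1 : s = a * Y - b * X := by rw [hX, hY]; linear_combination -e2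
  have hX1 : D * X = r * a + s * c := by rw [hr1, hs1, hDd]; ring
  have hY1 : D * Y = r * b + s * d := by rw [hr1, hs1, hDd]; ring
  have hD2 : 0 < D ^ 2 := by positivity
  have id : D ^ 2 * (X ^ 2 + Y ^ 2) =
      r ^ 2 * (a ^ 2 + b ^ 2) + s ^ 2 * (c ^ 2 + d ^ 2) + 2 * (r * s) * (a * c + b * d) := by
    have : D ^ 2 * (X ^ 2 + Y ^ 2) = (D * X) ^ 2 + (D * Y) ^ 2 := by ring
    rw [this, hX1, hY1]; ring
  by_cases hs0 : s = 0
  · rw [hs0] at id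
    nlinarith [mul_le_mul_of_nonneg_left k1 hD2.le, mul_pos hD2 hwp,
      mul_le_mul_of_nonneg_right hr hwp.le]
  · have k4 := k2 (fun ⟨t, ht⟩ => hs0 (by
      have h1 := congrArg Prod.fst ht
      have h2 := congrArg Prod.snd ht
      simp at h1 h2
      rw [hs1, hX, hY, h1, h2]; ring))
    have q1 : |2 * (a * c + b * d)| ≤ a ^ 2 + b ^ 2 := abs_le.2 ⟨by linarith, by linarith⟩
    have q2 : 4 * |r * s| ≤ D ^ 2 := by
      rcases abs_cases (r * s) with ⟨h, _⟩ | ⟨h, _⟩ <;> rw [h] <;>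
        linarith [sq_nonneg (r - s), sq_nonneg (r + s)]
    have q3 : 4 * (2 * (r * s) * (a * c + b * d)) ≤ D ^ 2 * (a ^ 2 + b ^ 2) := by
      calc 4 * (2 * (r * s) * (a * c + b * d)) ≤ |4 * (2 * (r * s) * (a * c + b * d))| :=
            le_abs_self _
        _ = (4 * |r * s|) * |2 * (a * c + b * d)| := by
            rw [show 4 * (2 * (r * s) * (a * c + b * d)) =
              4 * (r * s) * (2 * (a * c + b * d)) by ring, abs_mul, abs_mul 4]; rfl
        _ ≤ _ := mul_le_mul q2 q1 (abs_nonneg _) hD2.le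
    linarith [mul_le_mul_of_nonneg_left k4 hD2.le, mul_pos hD2 hup,
      mul_le_mul_of_nonneg_right hr hwp.le, mul_le_mul_of_nonneg_right hs hup.le,
      mul_le_mul_of_nonneg_left hwu hD2.le]

/-- For an odd prime `p` and `2 ≤ μ ≤ p−2`, if `w` is a nonzero element of
`Λ_μ(p)` of minimal Euclidean norm, then `Λ_μ(p)` has a monochromatic basis one of
whose two elements is either `w` itself or an element of minimal Euclidean norm
among the elements of `Λ_μ(p) ∖ ℤw`. -/
theorem stmt15 (p : ℕ) (hp : p.Prime) (hodd : Odd p)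
    (μ : ℤ) (hμ₁ : 2 ≤ μ) (hμ₂ : μ ≤ (p : ℤ) - 2)
    (w : ℤ × ℤ) (hw : w ∈ Lam p μ) (hw0 : w ≠ 0)
    (hmin : ∀ v ∈ Lam p μ, v ≠ 0 → w.1 ^ 2 + w.2 ^ 2 ≤ v.1 ^ 2 + v.2 ^ 2) :
    ∃ b₁ b₂ : ℤ × ℤ,
      (IsMonoBasis Black (Lam p μ) b₁ b₂ ∨ IsMonoBasis White (Lam p μ) b₁ b₂) ∧
      ((b₁ = w ∨
          (b₁ ∈ Lam p μ ∧ (¬ ∃ n : ℤ, b₁ = n • w) ∧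
            ∀ v ∈ Lam p μ, (¬ ∃ n : ℤ, v = n • w) →
              b₁.1 ^ 2 + b₁.2 ^ 2 ≤ v.1 ^ 2 + v.2 ^ 2)) ∨
        (b₂ = w ∨
          (b₂ ∈ Lam p μ ∧ (¬ ∃ n : ℤ, b₂ = n • w) ∧
            ∀ v ∈ Lam p μ, (¬ ∃ n : ℤ, v = n • w) →
              b₂.1 ^ 2 + b₂.2 ^ 2 ≤ v.1 ^ 2 + v.2 ^ 2))) := by
  have hp3 : (4 : ℤ) ≤ p := by omega
  have m1 : ((p : ℤ), (0 : ℤ)) ∈ Lam p μ := by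
    change (p : ℤ) ∣ (p : ℤ) + μ * 0
    simp
  have m2 : (-μ, (1 : ℤ)) ∈ Lam p μ := by
    change (p : ℤ) ∣ -μ + μ * 1
    simp
  have hex : ∃ v ∈ Lam p μ, ¬ ∃ n : ℤ, v = n • w := by
    by_contra hcon
    push Not at hcon
    obtain ⟨n, hn⟩ := hcon _ m1
    obtain ⟨m, hm⟩ := hcon _ m2
    have a1 : (p : ℤ) = n * w.1 := congrArg Prod.fst hn
    have a2 : (0 : ℤ) = n * w.2 := congrArg Prod.snd hn
    have a3 : (1 : ℤ) = m * w.2 := congrArg Prod.snd hm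
    rcases mul_eq_zero.1 a2.symm with h | h
    · rw [h] at a1; omega
    · rw [h] at a3; omega
  obtain ⟨u, hu, hn, humin⟩ := exists_u _ w hex
  have hgen := gen _ hw hw0 hmin hu hn humin
  have hD := det_ne _ hw hw0 hmin hu hn
  have hu0 : u ≠ 0 := by rintro rfl; exact hn ⟨0, by simp⟩
  have hwu := hmin u hu hu0
  have nm : ¬ ∃ n : ℤ, u - w = n • w := by
    rintro ⟨t, ht⟩; exact hn ⟨t + 1, by rw [add_smul, one_smul, ← ht]; abel⟩
  have np : ¬ ∃ n : ℤ, u + w = n • w := by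
    rintro ⟨t, ht⟩; exact hn ⟨t - 1, by rw [sub_smul, one_smul, ← ht]; abel⟩
  have hum := (Lam p μ).sub_mem hu hw
  have hup := (Lam p μ).add_mem hu hw
  have l1 := humin _ hum nm
  have l2 := humin _ hup np
  have um0 : u - w ≠ 0 := fun h => nm ⟨0, by simp [h]⟩
  have up0 : u + w ≠ 0 := fun h => np ⟨0, by simp [h]⟩
  have hcl : AddSubgroup.closure {w, u} = Lam p μ := by
    apply le_antisymm
    · rw [AddSubgroup.closure_le]
      rintro v (rfl | rfl)
      · exact hw
      · exact hu
    · intro v hv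
      obtain ⟨m, n, e⟩ := hgen v hv
      exact AddSubgroup.mem_closure_pair.2 ⟨m, n, e.symm⟩
  have hDp : (w.1 * u.2 - w.2 * u.1) ^ 2 ≤ (p : ℤ) ^ 2 := by
    obtain ⟨m, n, e⟩ := hgen _ m1
    obtain ⟨m', n', e'⟩ := hgen _ m2
    have a1 : (p : ℤ) = m * w.1 + n * u.1 := congrArg Prod.fst e
    have a2 : (0 : ℤ) = m * w.2 + n * u.2 := congrArg Prod.snd e
    have a3 : -μ = m' * w.1 + n' * u.1 := congrArg Prod.fst e'
    have a4 : (1 : ℤ) = m' * w.2 + n' * u.2 := congrArg Prod.snd e'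
    have hdv : (w.1 * u.2 - w.2 * u.1) ∣ (p : ℤ) := by
      refine ⟨m * n' - n * m', ?_⟩
      have : (p : ℤ) = (p : ℤ) * 1 - 0 * (-μ) := by ring
      rw [this, a4, a1, a3, a2]; ring
    have := Int.le_of_dvd (by positivity) (pow_dvd_pow_of_dvd hdv 2)
    exact this
  have hwp := normpos hw0
  -- |w|² |u|² ≤ 4/3 p²
  have hprod : 3 * ((w.1 ^ 2 + w.2 ^ 2) * (u.1 ^ 2 + u.2 ^ 2)) ≤ 4 * (p : ℤ) ^ 2 := by
    simp only [Prod.fst_sub, Prod.snd_sub, Prod.fst_add, Prod.snd_add] at l1 l2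
    have q : (2 * (w.1 * u.1 + w.2 * u.2)) ^ 2 ≤ (w.1 ^ 2 + w.2 ^ 2) ^ 2 :=
      sq_le_sq' (by linarith) (by linarith)
    have := mul_le_mul_of_nonneg_left hwu hwp.le
    nlinarith
  have wNZ : NZ w.1 w.2 := by
    apply lam_nz hp hμ₁ hμ₂ hw hw0
    by_contra hcon
    push Not at hcon
    have h1 := mul_le_mul hcon (hcon.trans hwu) (by positivity) hwp.le
    nlinarith
  have w5 : 5 ≤ w.1 ^ 2 + w.2 ^ 2 := by
    obtain ⟨e1, e2⟩ := wNZ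
    have h1 : 1 ≤ w.1 ^ 2 := by
      have : w.1 ≠ 0 := by intro h; simp [h] at e1
      have : 0 < w.1 ^ 2 := by positivity
      omega
    have h2 : 1 ≤ w.2 ^ 2 := by
      have : w.2 ≠ 0 := by intro h; simp [h] at e1
      have : 0 < w.2 ^ 2 := by positivity
      omega
    by_contra hcon
    have b1 : w.1 ^ 2 < 2 ^ 2 := by omega
    have b2 : w.2 ^ 2 < 2 ^ 2 := by omega
    have c1 := abs_lt.1 (abs_lt_of_sq_lt_sq b1 (by norm_num))
    have c2 := abs_lt.1 (abs_lt_of_sq_lt_sq b2 (by norm_num))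
    have d1 : w.1 ^ 2 ≤ 1 := by nlinarith
    have d2 : w.2 ^ 2 ≤ 1 := by nlinarith
    omega
  have hbig : 3 * (u.1 ^ 2 + u.2 ^ 2) < (p : ℤ) ^ 2 := by nlinarith
  have uNZ : NZ u.1 u.2 := lam_nz hp hμ₁ hμ₂ hu hu0 (by nlinarith)
  have umNZ : NZ (u.1 - w.1) (u.2 - w.2) := by
    apply lam_nz hp hμ₁ hμ₂ hum um0
    simp only [Prod.fst_sub, Prod.snd_sub, Prod.fst_add, Prod.snd_add] at l1 l2 ⊢
    linarith
  have upNZ : NZ (u.1 + w.1) (u.2 + w.2) := by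
    apply lam_nz hp hμ₁ hμ₂ hup up0
    simp only [Prod.fst_sub, Prod.snd_sub, Prod.fst_add, Prod.snd_add] at l1 l2 ⊢
    linarith
  rcases core5 (⟨wNZ, uNZ, umNZ, upNZ, hwu, l1, l2⟩ : Hyp w.1 w.2 u.1 u.2) with
    h | h | h | h | h
  · exact ⟨w, u, good_mono hcl h, Or.inl (Or.inl rfl)⟩
  · exact ⟨w, u - w, good_mono (clos hcl hw hum ⟨1, 0, by simp⟩ ⟨1, 1, by simp⟩) h,
      Or.inl (Or.inl rfl)⟩
  · exact ⟨w, u + w, good_mono (clos hcl hw hup ⟨1, 0, by simp⟩ ⟨-1, 1, by simp⟩) h,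
      Or.inl (Or.inl rfl)⟩
  · exact ⟨u, u - w, good_mono (clos hcl hu hum ⟨1, -1, by simp⟩ ⟨1, 0, by simp⟩) h,
      Or.inl (Or.inr ⟨hu, hn, humin⟩)⟩
  · exact ⟨u, u + w, good_mono (clos hcl hu hup ⟨-1, 1, by simp⟩ ⟨1, 0, by simp⟩) h,
      Or.inl (Or.inr ⟨hu, hn, humin⟩)⟩
end
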